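/- arXiv:1002.1229 — 2 statements merged into one kernel-verified Lean document; each statement's English description precedes it below -/
import Mathlib

section
/- For every n ≥ 0, the number of involutions of {1,2,…,n+1} that avoid both of the patterns 1243 and 2143 equals the number of Schröder paths p of length n satisfying rev(p) = p. -/
/-- A step of a lattice path: `E = (1,0)`, `N = (0,1)`, `D = (1,1)`. -/
inductive Step : Type
  | E : Step
  | N : Step
  | D : Step
  deriving DecidableEq

/-- The x-coordinate of the lattice point reached after performing the steps `q`
(starting from the origin). -/
def posX (q : List Step) : ℕ := q.count Step.E + q.count Step.D

/-- The y-coordinate of the lattice point reached after performing the steps `q`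
(starting from the origin). -/
def posY (q : List Step) : ℕ := q.count Step.N + q.count Step.D

/-- A Schröder prefix: a lattice path starting at the origin which never passes
below the line `y = x`. -/
def IsSchroderPrefix (p : List Step) : Prop :=
  ∀ q : List Step, q <+: p → posX q ≤ posY q

/-- A Schröder path of length `n`: a Schröder prefix terminating at `(n, n)`. -/
def IsSchroderPath (n : ℕ) (p : List Step) : Prop :=
  IsSchroderPrefix p ∧ posX p = n ∧ posY p = n

/-- Interchange `E` and `N` steps. -/
def revStep : Step → Step
  | Step.E => Step.N
  | Step.N => Step.E
  | Step.D => Step.D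

/-- The reversal of a Schröder path: write the steps in reverse order and
interchange `E` and `N` steps. -/
def revPath (p : List Step) : List Step := p.reverse.map revStep

/-- Words which are concatenations of blocks, each block being a single `D` step or
of the form `N^k E^k` for some `k > 0`. -/
inductive IsInnerWord : List Step → Prop
  | nil : IsInnerWord []
  | dcons {p : List Step} : IsInnerWord p → IsInnerWord (Step.D :: p)
  | peak {k : ℕ} {p : List Step} : 0 < k → IsInnerWord p →
      IsInnerWord (List.replicate k Step.N ++ List.replicate k Step.E ++ p)

/-- Words which are concatenations of blocks, each block being a single `D` step or of
the form `N q E` where `q` is an inner word. -/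
inductive IsDWord : List Step → Prop
  | nil : IsDWord []
  | dcons {p : List Step} : IsDWord p → IsDWord (Step.D :: p)
  | block {q p : List Step} : IsInnerWord q → IsDWord p →
      IsDWord (Step.N :: (q ++ Step.E :: p))

/-- Membership in `𝒟_n`: a Schröder path of length `n` of the prescribed block form. -/
def MemD (n : ℕ) (p : List Step) : Prop := IsDWord p ∧ IsSchroderPath n p

/-- Membership in `𝒟`: Schröder prefixes occurring as initial segments of some
path in `𝒟_m` for some finite `m`. -/
def MemCalD (p : List Step) : Prop := ∃ (m : ℕ) (q : List Step), p <+: q ∧ MemD m q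

/-- `p` has a level feature at `t`: a `D` step joining `(t-1, t)` to `(t, t+1)`. -/
def HasLevelFeatureAt (p : List Step) (t : ℕ) : Prop :=
  1 ≤ t ∧ ∃ q r : List Step, p = q ++ Step.D :: r ∧ posX q = t - 1 ∧ posY q = t

/-- `p` has a notch feature at `t`: an `E` step joining `(t-1, t)` to `(t, t)`
immediately followed by an `N` step joining `(t, t)` to `(t, t+1)`. -/
def HasNotchFeatureAt (p : List Step) (t : ℕ) : Prop :=
  1 ≤ t ∧ ∃ q r : List Step, p = q ++ Step.E :: Step.N :: r ∧ posX q = t - 1 ∧ posY q = t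

/-- `p` has no (level or notch) features. -/
def Featureless (p : List Step) : Prop :=
  ∀ t : ℕ, ¬ HasLevelFeatureAt p t ∧ ¬ HasNotchFeatureAt p t

/-- Auxiliary function for `psi`, processing the path left to right while keeping track of
the current height `y - x` above the diagonal: at height `1`, a `D` step (a level feature)
is replaced by `E N` (a notch feature) and vice versa; all other steps are unchanged. -/
def psiAux : ℕ → List Step → List Step
  | 1, Step.D :: rest => Step.E :: Step.N :: psiAux 1 rest
  | 1, Step.E :: Step.N :: rest => Step.D :: psiAux 1 rest
  | h, Step.N :: rest => Step.N :: psiAux (h + 1) rest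
  | h, Step.E :: rest => Step.E :: psiAux (h - 1) rest
  | h, Step.D :: rest => Step.D :: psiAux h rest
  | _, [] => []
  termination_by h l => l.length

/-- `psi p` replaces every level feature of `p` by a notch feature at the same place and
vice versa, leaving all other steps unchanged. -/
def psi (p : List Step) : List Step := psiAux 0 p

/-- `a i`: the number of Schröder prefixes in `𝒟` terminating at `(i, i)`. -/
noncomputable def aSeq (i : ℕ) : ℕ :=
  Set.ncard {p : List Step | MemCalD p ∧ posX p = i ∧ posY p = i}

/-- `b i`: the number of Schröder prefixes in `𝒟` terminating at `(i-1, i)` (and `b 0 = 0`). -/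
noncomputable def bSeq (i : ℕ) : ℕ :=
  Set.ncard {p : List Step | MemCalD p ∧ posX p + 1 = i ∧ posY p = i}

/-- `c i`: the number of featureless Schröder prefixes in `𝒟` terminating at `(i, i)`. -/
noncomputable def cSeq (i : ℕ) : ℕ :=
  Set.ncard {p : List Step | MemCalD p ∧ Featureless p ∧ posX p = i ∧ posY p = i}

/-- `d i`: the number of featureless Schröder prefixes in `𝒟` terminating at `(i-1, i)`
(and `d 0 = 0`). -/
noncomputable def dSeq (i : ℕ) : ℕ :=
  Set.ncard {p : List Step | MemCalD p ∧ Featureless p ∧ posX p + 1 = i ∧ posY p = i}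

/-- The permutation `π` (of `{1, …, n}`, 0-indexed as `Fin n`) contains the pattern `τ`
(a permutation of `{1, …, k}`, 0-indexed as `Fin k`). -/
def Contains {n k : ℕ} (π : Equiv.Perm (Fin n)) (τ : Equiv.Perm (Fin k)) : Prop :=
  ∃ f : Fin k → Fin n, StrictMono f ∧ ∀ a b : Fin k, τ a < τ b ↔ π (f a) < π (f b)

/-- The permutation `π` avoids the pattern `τ`. -/
def Avoids {n k : ℕ} (π : Equiv.Perm (Fin n)) (τ : Equiv.Perm (Fin k)) : Prop :=
  ¬ Contains π τ

/-- The reverse-complement of a permutation: `rc π (i) = (n+1) - π (n+1-i)` (1-indexed),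
i.e. `rc π (i) = rev (π (rev i))` in 0-indexed form. -/
def rc {n : ℕ} (π : Equiv.Perm (Fin n)) : Equiv.Perm (Fin n) :=
  (Fin.revPerm.trans π).trans Fin.revPerm

/-- The pattern `1243` (0-indexed: `0 ↦ 0, 1 ↦ 1, 2 ↦ 3, 3 ↦ 2`). -/
def pat1243 : Equiv.Perm (Fin 4) := Equiv.swap 2 3

/-- The pattern `2143` (0-indexed: `0 ↦ 1, 1 ↦ 0, 2 ↦ 3, 3 ↦ 2`). -/
def pat2143 : Equiv.Perm (Fin 4) := Equiv.swap 0 1 * Equiv.swap 2 3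

/-- The pattern `2134` (0-indexed: `0 ↦ 1, 1 ↦ 0, 2 ↦ 2, 3 ↦ 3`). -/
def pat2134 : Equiv.Perm (Fin 4) := Equiv.swap 0 1



def upk (k i : ℕ) : ℕ := if i < k then i else i + 1
def dnk (k i : ℕ) : ℕ := if i < k then i else i - 1

def GoodInv (n : ℕ) (f : ℕ → ℕ) : Prop :=
  (∀ i, f (f i) = i) ∧ (∀ i, n ≤ i → f i = i) ∧
  ∀ a b c d, a < b → b < c → c < d → f a < f d → f b < f d → f d < f c → False

def ActS (n : ℕ) (f : ℕ → ℕ) (k : ℕ) : Prop :=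
  k ≤ n ∧ (∀ a b d, a < b → b < k → k ≤ d → d < n → f a < f d → f b < f d → False) ∧
  (∀ a b, a < b → b < k → f a < k → f b < k → False)

def insI (n : ℕ) (f : ℕ → ℕ) (k i : ℕ) : ℕ :=
  if i = k then n + 1 else if i = n + 1 then k else if n + 1 < i then i
  else upk k (f (dnk k i))

def delI (n : ℕ) (g : ℕ → ℕ) (i : ℕ) : ℕ :=
  if i < n then dnk (g (n + 1)) (g (upk (g (n + 1)) i)) else i

lemma GoodInv.lt {n f} (h : GoodInv n f) {i} (hi : i < n) : f i < n := by
  by_contra hc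
  have h1 := h.2.1 (f i) (by omega)
  rw [h.1] at h1
  omega

/-- `g` is obtained from `f` by inserting the transposition `(k, n+1)`. -/
structure RelI (n : ℕ) (f : ℕ → ℕ) (k : ℕ) (g : ℕ → ℕ) : Prop where
  kn : k ≤ n
  gk : g k = n + 1
  gn : g (n + 1) = k
  gu : ∀ j, j < n → g (upk k j) = upk k (f j)
  gf : ∀ i, n + 2 ≤ i → g i = i
  ff : ∀ i, n ≤ i → f i = i
  fl : ∀ i, i < n → f i < n

lemma upk_lt {k i j : ℕ} : upk k i < upk k j ↔ i < j := by
  unfold upk; split_ifs <;> omega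

lemma upk_inj {k i j : ℕ} : upk k i = upk k j ↔ i = j := by
  unfold upk; split_ifs <;> omega

lemma upk_lt_self {k i : ℕ} : upk k i < k ↔ i < k := by
  unfold upk; split_ifs <;> omega

lemma self_lt_upk {k i : ℕ} : k < upk k i ↔ k ≤ i := by
  unfold upk; split_ifs <;> omega

lemma upk_lt_succ {k i j : ℕ} (h : k ≤ j) : upk k i < j + 1 ↔ i < j := by
  unfold upk; split_ifs <;> omega

lemma upk_ne {k i : ℕ} : upk k i ≠ k := by
  unfold upk; split_ifs <;> omega

lemma exists_upk {n k i : ℕ} (hk : k ≤ n) (hi : i < n + 1) (h : i ≠ k) :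
    ∃ j, j < n ∧ i = upk k j := by
  refine ⟨dnk k i, ?_, ?_⟩ <;> unfold dnk <;> (try unfold upk) <;> split_ifs <;> omega

lemma upk_bound {n k i : ℕ} (hi : i < n) : upk k i < n + 1 := by
  unfold upk; split_ifs <;> omega

lemma dnk_upk {k i : ℕ} : dnk k (upk k i) = i := by
  unfold upk dnk; split_ifs <;> omega

lemma insI_rel {n f k} (hf : GoodInv n f) (hk : k ≤ n) : RelI n f k (insI n f k) := by
  refine ⟨hk, by simp [insI], ?_, ?_, ?_, hf.2.1, fun i hi => hf.lt hi⟩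
  · unfold insI; split_ifs <;> omega
  · intro j hj
    have h1 := @upk_bound n k j hj
    have h2 := @upk_ne k j
    unfold insI
    rw [if_neg h2, if_neg (by omega), if_neg (by omega), dnk_upk]
  · intro i hi
    unfold insI
    rw [if_neg (by omega), if_neg (by omega), if_pos (by omega)]

lemma RelI.cases {n f k g} (r : RelI n f k g) (i : ℕ) :
    i = k ∨ i = n + 1 ∨ n + 2 ≤ i ∨ ∃ j, j < n ∧ i = upk k j := by
  by_cases h1 : i = k
  · exact Or.inl h1
  by_cases h2 : i < n + 1
  · exact Or.inr (Or.inr (Or.inr (exists_upk r.kn h2 h1)))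
  · omega

lemma RelI.unique {n f k g g'} (r : RelI n f k g) (r' : RelI n f k g') : g = g' := by
  funext i
  rcases r.cases i with h | h | h | ⟨j, hj, h⟩
  · rw [h, r.gk, r'.gk]
  · rw [h, r.gn, r'.gn]
  · rw [r.gf _ h, r'.gf _ h]
  · rw [h, r.gu _ hj, r'.gu _ hj]

lemma RelI.unique_left {n f f' k g} (r : RelI n f k g) (r' : RelI n f' k g) : f = f' := by
  funext i
  by_cases h : i < n
  · have h1 := r.gu i h
    rw [r'.gu i h, upk_inj] at h1
    exact h1.symm
  · rw [r.ff i (by omega), r'.ff i (by omega)]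

lemma RelI.good {n f k g} (r : RelI n f k g) (hf : GoodInv n f) (ha : ActS n f k) :
    GoodInv (n + 2) g := by
  have glt : ∀ i, i < n + 2 → g i < n + 2 := by
    intro i hi
    rcases r.cases i with h | h | h | ⟨j, hj, h⟩
    · rw [h, r.gk]; omega
    · rw [h, r.gn]; have := r.kn; omega
    · omega
    · rw [h, r.gu _ hj]; have := @upk_bound n k _ (r.fl _ hj); omega
  refine ⟨?_, r.gf, ?_⟩
  · intro i
    rcases r.cases i with h | h | h | ⟨j, hj, h⟩
    · rw [h, r.gk, r.gn]
    · rw [h, r.gn, r.gk]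
    · rw [r.gf _ h, r.gf _ h]
    · rw [h, r.gu _ hj, r.gu _ (r.fl _ hj), hf.1]
  · intro a b c d hab hbc hcd had hbd hdc
    have hd : d < n + 2 := by
      by_contra hd
      rw [r.gf d (by omega)] at hdc
      by_cases hc : c < n + 2
      · have := glt c hc; omega
      · rw [r.gf c (by omega)] at hdc; omega
    -- `a` and `b` are old
    have old : ∀ i, i < d → g i < g d → ∃ j, j < n ∧ i = upk k j := by
      intro i hi hgi
      rcases r.cases i with h | h | h | h
      · rw [h, r.gk] at hgi; have := glt d hd; omega
      · omega
      · omega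
      · exact h
    obtain ⟨a', ha', rfl⟩ := old a (by omega) had
    obtain ⟨b', hb', rfl⟩ := old b (by omega) hbd
    rw [upk_lt] at hab
    rw [r.gu _ ha'] at had
    rw [r.gu _ hb'] at hbd
    rcases r.cases d with h | h | h | ⟨d', hd', rfl⟩
    · rw [h, r.gk] at hdc; have := glt c (by omega); omega
    · rw [h, r.gn] at hdc had hbd
      rw [upk_lt_self] at had hbd
      rcases r.cases c with h' | h' | h' | ⟨c', hc', rfl⟩
      · rw [h', upk_lt_self] at hbc
        exact ha.2.2 a' b' hab hbc had hbd
      · omega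
      · omega
      · rw [upk_lt] at hbc
        rw [r.gu _ hc', self_lt_upk] at hdc
        have hfc := r.fl _ hc'
        rcases lt_trichotomy (f a') (f b') with h1 | h1 | h1
        · refine ha.2.1 (f a') (f b') (f c') h1 hbd hdc hfc ?_ ?_ <;> simp only [hf.1] <;> omega
        · have := congrArg f h1
          rw [hf.1, hf.1] at this; omega
        · refine ha.2.1 (f b') (f a') (f c') h1 had hdc hfc ?_ ?_ <;> simp only [hf.1] <;> omega
    · omega
    · rw [r.gu _ hd'] at had hbd hdc
      rw [upk_lt] at had hbd
      rcases r.cases c with h' | h' | h' | ⟨c', hc', rfl⟩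
      · subst h'
        rw [upk_lt_self] at hbc
        rw [self_lt_upk] at hcd
        exact ha.2.1 a' b' d' hab hbc hcd hd' had hbd
      · omega
      · omega
      · rw [upk_lt] at hbc hcd
        rw [r.gu _ hc', upk_lt] at hdc
        exact hf.2.2 a' b' c' d' hab hbc hcd had hbd hdc

lemma delI_rel {n g} (hg : GoodInv (n + 2) g) (h : g (n + 1) ≠ n + 1) :
    RelI n (delI n g) (g (n + 1)) g := by
  have hk : g (n + 1) ≤ n := by have := hg.lt (show n + 1 < n + 2 by omega); omega
  have key : ∀ j, j < n → ∃ m, m < n ∧ g (upk (g (n + 1)) j) = upk (g (n + 1)) m := by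
    intro j hj
    refine exists_upk hk ?_ ?_
    · have h1 := @upk_bound n (g (n + 1)) j hj
      have h2 := hg.lt (show upk (g (n + 1)) j < n + 2 by omega)
      have h3 : g (upk (g (n + 1)) j) ≠ n + 1 := by
        intro h4
        have := congrArg g h4
        rw [hg.1] at this
        exact upk_ne this
      omega
    · intro h4
      have := congrArg g h4
      rw [hg.1, hg.1] at this
      have h1 := @upk_bound n (g (n + 1)) j hj
      omega
  refine ⟨hk, hg.1 _, rfl, ?_, hg.2.1, ?_, ?_⟩
  · intro j hj
    obtain ⟨m, hm, e⟩ := key j hj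
    rw [e]; simp only [delI, if_pos hj, e, dnk_upk]
  · intro i hi
    simp only [delI, if_neg (show ¬ i < n by omega)]
  · intro j hj
    obtain ⟨m, hm, e⟩ := key j hj
    simp only [delI, if_pos hj, e, dnk_upk, hm]

lemma RelI.good_left {n f k g} (r : RelI n f k g) (hg : GoodInv (n + 2) g) :
    GoodInv n f ∧ ActS n f k := by
  refine ⟨⟨?_, r.ff, ?_⟩, r.kn, ?_, ?_⟩
  · intro i
    by_cases hi : i < n
    · have := hg.1 (upk k i)
      rw [r.gu _ hi, r.gu _ (r.fl _ hi), upk_inj] at this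
      exact this
    · rw [r.ff i (by omega), r.ff i (by omega)]
  · intro a b c d hab hbc hcd had hbd hdc
    have hd : d < n := by
      by_contra hd
      rw [r.ff d (by omega)] at hdc
      by_cases hc : c < n
      · have := r.fl c hc; omega
      · rw [r.ff c (by omega)] at hdc; omega
    refine hg.2.2 (upk k a) (upk k b) (upk k c) (upk k d) (upk_lt.2 hab) (upk_lt.2 hbc)
      (upk_lt.2 hcd) ?_ ?_ ?_
    · rw [r.gu _ (by omega), r.gu _ (by omega), upk_lt]; exact had
    · rw [r.gu _ (by omega), r.gu _ (by omega), upk_lt]; exact hbd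
    · rw [r.gu _ (by omega), r.gu _ (by omega), upk_lt]; exact hdc
  · intro a b d hab hbk hkd hd had hbd
    have := r.kn
    refine hg.2.2 (upk k a) (upk k b) k (upk k d) (upk_lt.2 hab) (upk_lt_self.2 hbk)
      (self_lt_upk.2 hkd) ?_ ?_ ?_
    · rw [r.gu _ (by omega), r.gu _ (by omega), upk_lt]; exact had
    · rw [r.gu _ (by omega), r.gu _ (by omega), upk_lt]; exact hbd
    · rw [r.gu _ (by omega), r.gk]; exact upk_bound (r.fl _ hd)
  · intro a b hab hbk hak hbk'
    have := r.kn
    refine hg.2.2 (upk k a) (upk k b) k (n + 1) (upk_lt.2 hab) (upk_lt_self.2 hbk)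
      (by omega) ?_ ?_ ?_
    · rw [r.gu _ (by omega), r.gn, upk_lt_self]; exact hak
    · rw [r.gu _ (by omega), r.gn, upk_lt_self]; exact hbk'
    · rw [r.gk, r.gn]; omega

lemma act_zero (n f) : ActS n f 0 := ⟨by omega, by intros; omega, by intros; omega⟩
lemma act_one {n f} (hn : 1 ≤ n) : ActS n f 1 := ⟨by omega, by intros; omega, by intros; omega⟩

lemma act_full {n f j} (hf : GoodInv n f) (hj : n ≤ j) (h2 : 2 ≤ n) : ¬ ActS n f j := by
  intro h
  have : j = n := le_antisymm h.1 hj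
  subst this
  exact h.2.2 0 1 (by omega) (by omega) (hf.lt (by omega)) (hf.lt (by omega))

lemma act_fix {n f} (hf : GoodInv n f) (hn : 1 ≤ n) (j : ℕ) :
    ActS (n + 1) f j ↔ j = 0 ∨ j = 1 := by
  constructor
  · intro h
    by_contra hc
    by_cases hj : j ≤ n
    · refine h.2.1 0 1 n (by omega) (by omega) hj (by omega) ?_ ?_ <;> rw [hf.2.1 n le_rfl]
      · exact hf.lt (by omega)
      · exact hf.lt (by omega)
    · refine h.2.2 0 1 (by omega) (by omega) ?_ ?_
      · have := @GoodInv.lt n f hf 0 (by omega); omega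
      · by_cases h1 : n = 1
        · rw [hf.2.1 1 (by omega)]; omega
        · have := @GoodInv.lt n f hf 1 (by omega); omega
  · rintro (rfl | rfl)
    · exact act_zero _ _
    · exact act_one (by omega)

lemma act_ins {n f k g} (r : RelI n f k g) (hg : GoodInv (n + 2) g) (j : ℕ) :
    ActS (n + 2) g j ↔ j = 0 ∨ j = 1 ∨ ∃ i, k ≤ i ∧ ActS n f i ∧ j = i + 1 := by
  have hkn := r.kn
  constructor
  · intro h
    by_contra hc
    push Not at hc
    obtain ⟨h0, h1, h2⟩ := hc
    by_cases hjk : j ≤ k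
    · have key : ∀ i, i < k → g i < g k := by
        intro i hi
        have h3 := hg.lt (show i < n + 2 by omega)
        have h4 : g i ≠ g k := by
          intro h4
          have := congrArg g h4
          rw [hg.1, hg.1] at this; omega
        have := r.gk
        omega
      exact h.2.1 0 1 k (by omega) (by omega) hjk (by omega) (key _ (by omega)) (key _ (by omega))
    · by_cases hjn : j = n + 2
      · exact act_full hg (by omega) (by omega) h
      · have hjn' := h.1
        obtain ⟨i, rfl⟩ : ∃ i, j = i + 1 := ⟨j - 1, by omega⟩
        refine h2 i (by omega) ⟨by omega, ?_, ?_⟩ rfl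
        · intro a b d hab hbk hkd hd had hbd
          refine h.2.1 (upk k a) (upk k b) (upk k d) (upk_lt.2 hab)
            ((upk_lt_succ (by omega)).2 hbk) ?_ ?_ ?_ ?_
          · have := (@upk_lt_succ k d i (by omega)); omega
          · have := @upk_bound n k d hd; omega
          · rw [r.gu _ (by omega), r.gu _ (by omega), upk_lt]; exact had
          · rw [r.gu _ (by omega), r.gu _ (by omega), upk_lt]; exact hbd
        · intro a b hab hbk hak hbk'
          refine h.2.2 (upk k a) (upk k b) (upk_lt.2 hab) ((upk_lt_succ (by omega)).2 hbk) ?_ ?_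
          · rw [r.gu _ (by omega), upk_lt_succ (by omega)]; exact hak
          · rw [r.gu _ (by omega), upk_lt_succ (by omega)]; exact hbk'
  · rintro (rfl | rfl | ⟨i, hki, ha, rfl⟩)
    · exact act_zero _ _
    · exact act_one (by omega)
    · have hin := ha.1
      refine ⟨by omega, ?_, ?_⟩
      · intro a b d hab hbk hkd hd had hbd
        have old : ∀ x, x < i + 1 → g x < g d → ∃ j, j < n ∧ x = upk k j := by
          intro x hx hgx
          rcases r.cases x with h | h | h | h
          · rw [h, r.gk] at hgx; have := hg.lt hd; omega
          · omega
          · omega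
          · exact h
        obtain ⟨a', ha', rfl⟩ := old a (by omega) had
        obtain ⟨b', hb', rfl⟩ := old b (by omega) hbd
        rw [upk_lt] at hab
        rw [upk_lt_succ hki] at hbk
        rw [r.gu _ ha'] at had
        rw [r.gu _ hb'] at hbd
        rcases r.cases d with h | h | h | ⟨d', hd', rfl⟩
        · omega
        · rw [h, r.gn, upk_lt_self] at had hbd
          exact ha.2.2 a' b' hab hbk (by omega) (by omega)
        · omega
        · rw [r.gu _ hd', upk_lt] at had hbd
          have := @upk_lt_succ k d' i hki
          exact ha.2.1 a' b' d' hab hbk (by omega) hd' had hbd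
      · intro a b hab hbk hak hbk'
        have old : ∀ x, x < i + 1 → g x < i + 1 → ∃ j, j < n ∧ x = upk k j := by
          intro x hx hgx
          rcases r.cases x with h | h | h | h
          · rw [h, r.gk] at hgx; omega
          · omega
          · omega
          · exact h
        obtain ⟨a', ha', rfl⟩ := old a (by omega) hak
        obtain ⟨b', hb', rfl⟩ := old b (by omega) hbk'
        rw [r.gu _ ha', upk_lt_succ hki] at hak
        rw [r.gu _ hb', upk_lt_succ hki] at hbk'
        rw [upk_lt] at hab
        rw [upk_lt_succ hki] at hbk
        exact ha.2.2 a' b' hab hbk hak hbk'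

def extP (n : ℕ) (π : Equiv.Perm (Fin n)) (i : ℕ) : ℕ :=
  if h : i < n then (π ⟨i, h⟩ : ℕ) else i

lemma extP_val {n} (π : Equiv.Perm (Fin n)) (i : Fin n) : extP n π i = π i := by
  simp [extP]

lemma extP_inj {n} : Function.Injective (extP n) := by
  intro π π' h
  ext i
  rw [← extP_val, ← extP_val, h]

lemma contains1243 {n} (π : Equiv.Perm (Fin n)) :
    Contains π pat1243 ↔ ∃ a b c d, a < b ∧ b < c ∧ c < d ∧ π a < π b ∧ π b < π d ∧ π d < π c := by
  constructor
  · rintro ⟨f, hf, h⟩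
    refine ⟨f 0, f 1, f 2, f 3, hf (by decide), hf (by decide), hf (by decide),
      (h 0 1).1 (by decide), (h 1 3).1 (by decide), (h 3 2).1 (by decide)⟩
  · rintro ⟨a, b, c, d, h1, h2, h3, h4, h5, h6⟩
    refine ⟨![a, b, c, d], ?_, ?_⟩
    · rw [Fin.strictMono_iff_lt_succ]
      intro i; fin_cases i <;> simpa
    · intro x y
      fin_cases x <;> fin_cases y <;> simp [pat1243, Equiv.swap_apply_def] <;> order

lemma contains2143 {n} (π : Equiv.Perm (Fin n)) :
    Contains π pat2143 ↔ ∃ a b c d, a < b ∧ b < c ∧ c < d ∧ π b < π a ∧ π a < π d ∧ π d < π c := by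
  constructor
  · rintro ⟨f, hf, h⟩
    refine ⟨f 0, f 1, f 2, f 3, hf (by decide), hf (by decide), hf (by decide),
      (h 1 0).1 (by decide), (h 0 3).1 (by decide), (h 3 2).1 (by decide)⟩
  · rintro ⟨a, b, c, d, h1, h2, h3, h4, h5, h6⟩
    refine ⟨![a, b, c, d], ?_, ?_⟩
    · rw [Fin.strictMono_iff_lt_succ]
      intro i; fin_cases i <;> simpa
    · intro x y
      fin_cases x <;> fin_cases y <;> simp [pat2143, Equiv.swap_apply_def] <;> order

lemma ext_good {n} (π : Equiv.Perm (Fin n)) :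
    (π⁻¹ = π ∧ Avoids π pat1243 ∧ Avoids π pat2143) ↔ GoodInv n (extP n π) := by
  have hlt : ∀ i, i < n → extP n π i < n := by
    intro i hi
    rw [extP, dif_pos hi]; exact Fin.isLt _
  have hge : ∀ i, n ≤ i → extP n π i = i := by
    intro i hi
    rw [extP, dif_neg (by omega)]
  unfold Avoids
  rw [contains1243, contains2143]
  constructor
  · rintro ⟨h1, h2, h3⟩
    refine ⟨?_, hge, ?_⟩
    · intro i
      by_cases hi : i < n
      · have : extP n π i = π ⟨i, hi⟩ := extP_val π ⟨i, hi⟩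
        rw [this, extP_val]
        have h4 : π (π ⟨i, hi⟩) = ⟨i, hi⟩ := by
          nth_rewrite 1 [← h1]; simp
        rw [h4]
      · rw [hge i (by omega), hge i (by omega)]
    · intro a b c d hab hbc hcd had hbd hdc
      have hd : d < n := by
        by_contra hd
        rw [hge d (by omega)] at hdc
        by_cases hc : c < n
        · have := hlt c hc; omega
        · rw [hge c (by omega)] at hdc; omega
      rw [extP, extP, dif_pos (by omega), dif_pos (by omega)] at had hbd hdc
      have hne : (π ⟨a, by omega⟩) ≠ (π ⟨b, by omega⟩) := by
        intro h; have := π.injective h; simp at this; omega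
      rcases lt_or_gt_of_ne hne with h | h
      · exact h2 ⟨⟨a, by omega⟩, ⟨b, by omega⟩, ⟨c, by omega⟩, ⟨d, by omega⟩, hab, hbc, hcd, h, hbd, hdc⟩
      · exact h3 ⟨⟨a, by omega⟩, ⟨b, by omega⟩, ⟨c, by omega⟩, ⟨d, by omega⟩, hab, hbc, hcd, h, had, hdc⟩
  · rintro ⟨h1, -, h3⟩
    refine ⟨?_, ?_, ?_⟩
    · ext i
      have := h1 (i : ℕ)
      rw [extP_val, extP_val] at this
      have h5 : π (π i) = i := Fin.ext this
      nth_rewrite 1 [← h5]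
      simp
    · rintro ⟨a, b, c, d, hab, hbc, hcd, h4, h5, h6⟩
      refine h3 a b c d hab hbc hcd ?_ ?_ ?_ <;> simp only [extP_val]
      · exact h4.trans h5
      · exact h5
      · exact h6
    · rintro ⟨a, b, c, d, hab, hbc, hcd, h4, h5, h6⟩
      refine h3 a b c d hab hbc hcd ?_ ?_ ?_ <;> simp only [extP_val]
      · exact h5
      · exact h4.trans h5
      · exact h6

lemma ext_surj {n f} (hf : GoodInv n f) : ∃ π : Equiv.Perm (Fin n), extP n π = f := by
  let e : Fin n → Fin n := fun i => ⟨f i, hf.lt i.2⟩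
  have he : Function.Involutive e := by
    intro i; apply Fin.ext; exact hf.1 i
  refine ⟨he.toPerm e, ?_⟩
  funext i
  by_cases hi : i < n
  · rw [extP, dif_pos hi]; rfl
  · rw [extP, dif_neg hi, hf.2.1 i (by omega)]

lemma good_image (n : ℕ) : {f | GoodInv n f} =
    extP n '' {π : Equiv.Perm (Fin n) | π⁻¹ = π ∧ Avoids π pat1243 ∧ Avoids π pat2143} := by
  ext f
  simp only [Set.mem_ofPred_eq, Set.mem_image]
  constructor
  · intro hf
    obtain ⟨π, rfl⟩ := ext_surj hf
    exact ⟨π, (ext_good π).2 hf, rfl⟩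
  · rintro ⟨π, h, rfl⟩
    exact (ext_good π).1 h

lemma good_finite (n : ℕ) : {f | GoodInv n f}.Finite := by
  rw [good_image]; exact (Set.toFinite _).image _

noncomputable def Ig (n : ℕ) : Finset (ℕ → ℕ) := (good_finite n).toFinset

lemma mem_Ig {n f} : f ∈ Ig n ↔ GoodInv n f := by simp [Ig]

lemma card_Ig (n : ℕ) : Set.ncard {π : Equiv.Perm (Fin n) | π⁻¹ = π ∧ Avoids π pat1243 ∧
    Avoids π pat2143} = (Ig n).card := by
  rw [← Set.ncard_image_of_injective _ (@extP_inj n), ← good_image, Ig,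
    Set.ncard_eq_toFinset_card _ (good_finite n)]

open Classical in
noncomputable def actF (n : ℕ) (f : ℕ → ℕ) : Finset ℕ := (Finset.range (n + 1)).filter (ActS n f)

lemma mem_actF {n f k} : k ∈ actF n f ↔ ActS n f k := by
  simp only [actF, Finset.mem_filter, Finset.mem_range]
  exact ⟨fun h => h.2, fun h => ⟨by have := h.1; omega, h⟩⟩

noncomputable def labF (n : ℕ) (f : ℕ → ℕ) : ℕ := (actF n f).card - 2

lemma labF_fix {n f} (hf : GoodInv n f) (hn : 1 ≤ n) : labF (n + 1) f = 0 := by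
  have : actF (n + 1) f = {0, 1} := by
    ext j; simp [mem_actF, act_fix hf hn]
  rw [labF, this]; simp

lemma actF_ins {n f k} (hf : GoodInv n f) (hk : ActS n f k) :
    actF (n + 2) (insI n f k) =
      {0, 1} ∪ ((actF n f).filter (fun i => k ≤ i)).image (fun i => i + 1) := by
  have r := insI_rel hf hk.1
  ext j
  rw [mem_actF, act_ins r (r.good hf hk)]
  simp only [Finset.mem_union, Finset.mem_insert, Finset.mem_singleton, Finset.mem_image,
    Finset.mem_filter, mem_actF]
  constructor
  · rintro (h | h | ⟨i, h1, h2, h3⟩)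
    · exact Or.inl (Or.inl h)
    · exact Or.inl (Or.inr h)
    · exact Or.inr ⟨i, ⟨h2, h1⟩, h3.symm⟩
  · rintro ((h | h) | ⟨i, ⟨h2, h1⟩, h3⟩)
    · exact Or.inl h
    · exact Or.inr (Or.inl h)
    · exact Or.inr (Or.inr ⟨i, h1, h2, h3.symm⟩)

lemma two_le_act {n f} (hn : 1 ≤ n) : 2 ≤ (actF n f).card := by
  have : ({0, 1} : Finset ℕ) ⊆ actF n f := by
    intro j hj
    simp only [Finset.mem_insert, Finset.mem_singleton] at hj
    rw [mem_actF]
    rcases hj with rfl | rfl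
    · exact act_zero _ _
    · exact act_one hn
  simpa using Finset.card_le_card this

lemma labF_ins_zero {n f} (hn : 1 ≤ n) (hf : GoodInv n f) :
    labF (n + 2) (insI n f 0) = labF n f + 1 := by
  have h2 := @two_le_act n f hn
  have : actF (n + 2) (insI n f 0) = insert 0 ((actF n f).image (fun i => i + 1)) := by
    rw [actF_ins hf (act_zero _ _)]
    ext j
    have h0 := @mem_actF n f 0
    have h1 := act_zero n f
    simp only [Finset.mem_union, Finset.mem_insert, Finset.mem_singleton, Finset.mem_image,
      Finset.mem_filter]
    constructor
    · rintro ((h | h) | ⟨i, ⟨h2, _⟩, h3⟩)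
      · exact Or.inl h
      · exact Or.inr ⟨0, h0.2 h1, h.symm⟩
      · exact Or.inr ⟨i, h2, h3⟩
    · rintro (h | ⟨i, h2, h3⟩)
      · exact Or.inl (Or.inl h)
      · exact Or.inr ⟨i, ⟨h2, Nat.zero_le _⟩, h3⟩
  rw [labF, labF, this, Finset.card_insert_of_notMem (by simp),
    Finset.card_image_of_injective _ (fun a b h => by simpa using h)]
  omega

lemma labF_ins_pos {n f k} (hf : GoodInv n f) (hk : ActS n f k) (h0 : k ≠ 0) :
    labF (n + 2) (insI n f k) = ((actF n f).filter (fun i => k ≤ i)).card := by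
  rw [labF, actF_ins hf hk, Finset.card_union_of_disjoint,
    Finset.card_image_of_injective _ (fun a b h => by simpa using h)]
  · simp
  · rw [Finset.disjoint_left]
    intro j hj hj'
    simp only [Finset.mem_insert, Finset.mem_singleton, Finset.mem_image,
      Finset.mem_filter] at hj hj'
    obtain ⟨i, ⟨_, h⟩, rfl⟩ := hj'
    omega

lemma sum_rank (φ : ℕ → ℕ) (S : Finset ℕ) :
    ∑ k ∈ S, φ ((S.filter (fun i => k ≤ i)).card) = ∑ i ∈ Finset.range S.card, φ (i + 1) := by
  induction S using Finset.induction_on_min with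
  | empty => simp
  | insert a S ha ih =>
    have hn : a ∉ S := fun h => lt_irrefl _ (ha a h)
    rw [Finset.sum_insert hn, Finset.card_insert_of_notMem hn, Finset.sum_range_succ, ← ih,
      add_comm]
    congr 1
    · apply Finset.sum_congr rfl
      intro k hk
      rw [Finset.filter_insert, if_neg (by have := ha k hk; omega)]
    · rw [Finset.filter_true_of_mem, Finset.card_insert_of_notMem hn]
      intro i hi
      rcases Finset.mem_insert.1 hi with rfl | h
      · exact le_rfl
      · exact (ha i h).le

lemma sum_children (φ : ℕ → ℕ) {n f} (hn : 1 ≤ n) (hf : GoodInv n f) :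
    ∑ k ∈ actF n f, φ (labF (n + 2) (insI n f k)) =
      φ (labF n f + 1) + ∑ i ∈ Finset.range (labF n f + 1), φ (i + 1) := by
  have h0 : 0 ∈ actF n f := mem_actF.2 (act_zero _ _)
  have h2 := @two_le_act n f hn
  rw [← Finset.add_sum_erase _ _ h0, labF_ins_zero hn hf]
  congr 1
  have hc : labF n f + 1 = ((actF n f).erase 0).card := by
    rw [Finset.card_erase_of_mem h0, labF]; omega
  rw [hc, ← sum_rank]
  apply Finset.sum_congr rfl
  intro k hk
  rw [Finset.mem_erase] at hk
  rw [labF_ins_pos hf (mem_actF.1 hk.2) hk.1]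
  congr 2
  ext i
  simp only [Finset.mem_filter, Finset.mem_erase]
  constructor
  · rintro ⟨h, h'⟩; exact ⟨⟨by omega, h⟩, h'⟩
  · rintro ⟨⟨_, h⟩, h'⟩; exact ⟨h, h'⟩

lemma good_mono {n f} : GoodInv (n + 1) f ↔ GoodInv (n + 2) f ∧ f (n + 1) = n + 1 := by
  constructor
  · rintro ⟨h1, h2, h3⟩
    exact ⟨⟨h1, fun i hi => h2 i (by omega), h3⟩, h2 _ le_rfl⟩
  · rintro ⟨⟨h1, h2, h3⟩, h4⟩
    refine ⟨h1, fun i hi => ?_, h3⟩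
    rcases Nat.eq_or_lt_of_le hi with rfl | h
    · exact h4
    · exact h2 i h

lemma sum_rec0 (φ : ℕ → ℕ) (n : ℕ) :
    ∑ g ∈ Ig (n + 2), φ (labF (n + 2) g) = (Ig (n + 1)).card * φ 0 +
      ∑ f ∈ Ig n, ∑ k ∈ actF n f, φ (labF (n + 2) (insI n f k)) := by
  classical
  rw [← Finset.sum_filter_add_sum_filter_not (Ig (n + 2)) (fun g => g (n + 1) = n + 1)]
  congr 1
  · have : (Ig (n + 2)).filter (fun g => g (n + 1) = n + 1) = Ig (n + 1) := by
      ext f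
      rw [Finset.mem_filter, mem_Ig, mem_Ig]; exact good_mono.symm
    rw [this, Finset.sum_congr rfl (g := fun _ => φ 0)]
    · simp
    · intro f hf
      rw [labF_fix (mem_Ig.1 hf) (by omega)]
  · rw [Finset.sum_sigma']
    symm
    refine Finset.sum_bij' (fun x _ => insI n x.1 x.2) (fun g _ => ⟨delI n g, g (n + 1)⟩)
      ?_ ?_ ?_ ?_ ?_
    · rintro ⟨f, k⟩ h
      simp only [Finset.mem_sigma, mem_Ig, mem_actF] at h
      have r := insI_rel h.1 h.2.1
      simp only [Finset.mem_filter, mem_Ig]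
      refine ⟨r.good h.1 h.2, ?_⟩
      rw [r.gn]; have := h.2.1; omega
    · intro g h
      simp only [Finset.mem_filter, mem_Ig] at h
      simp only [Finset.mem_sigma, mem_Ig, mem_actF]
      exact (delI_rel h.1 h.2).good_left h.1
    · rintro ⟨f, k⟩ h
      simp only [Finset.mem_sigma, mem_Ig, mem_actF] at h
      have r := insI_rel h.1 h.2.1
      have hk := r.gn
      have r' := delI_rel (r.good h.1 h.2) (by rw [r.gn]; have := h.2.1; omega)
      rw [hk] at r'
      have hf := r'.unique_left r
      simp only [hf, hk]
    · intro g h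
      simp only [Finset.mem_filter, mem_Ig] at h
      have r := delI_rel h.1 h.2
      obtain ⟨h1, h2⟩ := r.good_left h.1
      exact (insI_rel h1 h2.1).unique r
    · intros; rfl

lemma sum_rec (φ : ℕ → ℕ) {n : ℕ} (hn : 1 ≤ n) :
    ∑ g ∈ Ig (n + 2), φ (labF (n + 2) g) = (Ig (n + 1)).card * φ 0 +
      ∑ f ∈ Ig n, (φ (labF n f + 1) + ∑ i ∈ Finset.range (labF n f + 1), φ (i + 1)) := by
  rw [sum_rec0]
  congr 1
  apply Finset.sum_congr rfl
  intro f hf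
  rw [sum_children φ hn (mem_Ig.1 hf)]

lemma Ig_small {n : ℕ} (hn : n ≤ 1) : Ig n = {id} := by
  ext f
  rw [mem_Ig, Finset.mem_singleton]
  constructor
  · intro h
    funext i
    by_cases hi : n ≤ i
    · exact h.2.1 i hi
    · have := @GoodInv.lt n f h i (by omega)
      simp only [id]; omega
  · rintro rfl
    exact ⟨fun i => rfl, fun i _ => rfl, fun a b c d _ _ _ _ _ h => by simp only [id] at h; omega⟩

lemma id_good (n : ℕ) : GoodInv n id :=
  ⟨fun i => rfl, fun i _ => rfl, fun a b c d _ _ _ _ _ h => by simp only [id] at h; omega⟩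

lemma sum_one (φ : ℕ → ℕ) : ∑ g ∈ Ig 1, φ (labF 1 g) = φ 0 := by
  rw [Ig_small le_rfl, Finset.sum_singleton]
  have : actF 1 id = {0, 1} := by
    ext j
    rw [mem_actF]
    simp only [Finset.mem_insert, Finset.mem_singleton]
    constructor
    · intro h; have := h.1; omega
    · rintro (rfl | rfl)
      · exact act_zero _ _
      · exact act_one le_rfl
  rw [labF, this]; simp

lemma sum_two (φ : ℕ → ℕ) : ∑ g ∈ Ig 2, φ (labF 2 g) = 2 * φ 0 := by
  rw [sum_rec0 φ 0, Ig_small le_rfl, Ig_small (Nat.zero_le _), Finset.sum_singleton]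
  have h0 : actF 0 id = {0} := by
    ext j
    rw [mem_actF]
    simp only [Finset.mem_singleton]
    constructor
    · intro h; have := h.1; omega
    · rintro rfl
      exact act_zero _ _
  have h1 : labF (0 + 2) (insI 0 id 0) = 0 := by
    rw [labF, actF_ins (id_good 0) (act_zero _ _), h0]
    decide
  rw [h0, Finset.sum_singleton, h1]
  simp; omega

/-- number of good involutions of size `n` with label at least `j` -/
noncomputable def VF (n j : ℕ) : ℕ := ∑ g ∈ Ig n, if j ≤ labF n g then 1 else 0

lemma VF_zero (n : ℕ) : VF n 0 = (Ig n).card := by simp [VF]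

lemma VF_one (j : ℕ) : VF 1 j = if j = 0 then 1 else 0 := by
  rw [VF, sum_one (fun x => if j ≤ x then 1 else 0)]; simp

lemma VF_two (j : ℕ) : VF 2 j = if j = 0 then 2 else 0 := by
  rw [VF, sum_two (fun x => if j ≤ x then 1 else 0)]; simp

lemma ch_count (h j : ℕ) : ((if j + 1 ≤ h + 1 then 1 else 0) +
    ∑ i ∈ Finset.range (h + 1), if j + 1 ≤ i + 1 then 1 else 0) =
    (if j ≤ h then 1 else 0) + (h + 1 - j) := by
  simp only [Nat.add_le_add_iff_right]
  congr 1
  generalize h + 1 = m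
  induction m with
  | zero => simp
  | succ m ih => rw [Finset.sum_range_succ, ih]; split_ifs <;> omega

lemma VF_rec (n j : ℕ) (hn : 1 ≤ n) :
    VF (n + 2) (j + 1) + VF n (j + 1) = VF (n + 2) (j + 2) + 2 * VF n j := by
  unfold VF
  rw [sum_rec (fun x => if j + 1 ≤ x then 1 else 0) hn,
    sum_rec (fun x => if j + 2 ≤ x then 1 else 0) hn]
  simp only [show ¬ (j + 1 ≤ 0) by omega, show ¬ (j + 2 ≤ 0) by omega, if_false, mul_zero, zero_add]
  rw [Finset.mul_sum, ← Finset.sum_add_distrib, ← Finset.sum_add_distrib]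
  apply Finset.sum_congr rfl
  intro f _
  rw [ch_count, ch_count]
  split_ifs <;> omega

lemma VF_rec0 (n : ℕ) (hn : 1 ≤ n) : VF (n + 2) 0 = VF (n + 2) 1 + VF (n + 1) 0 := by
  rw [VF_zero (n + 1)]
  unfold VF
  rw [sum_rec (fun x => if 0 ≤ x then 1 else 0) hn,
    sum_rec (fun x => if 1 ≤ x then 1 else 0) hn]
  simp; ring

lemma VF_vanish (n j : ℕ) (hj : n < j) : VF n j = 0 := by
  unfold VF
  apply Finset.sum_eq_zero
  intro g _
  rw [if_neg]
  have : (actF n g).card ≤ n + 1 := by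
    have := Finset.card_le_card (show actF n g ⊆ Finset.range (n + 1) by
      intro k hk; rw [mem_actF] at hk; have := hk.1; simp; omega)
    simpa using this
  unfold labF; omega

/-- Reversed Schröder prefixes. -/
def RPath (l : List Step) : Prop := ∀ r : List Step, r <:+ l → posX r ≤ posY r

lemma RPath_nil : RPath [] := by
  intro r hr
  rw [List.suffix_nil] at hr
  subst hr; simp [posX, posY]

lemma RPath_cons (s : Step) (l : List Step) :
    RPath (s :: l) ↔ posX (s :: l) ≤ posY (s :: l) ∧ RPath l := by
  unfold RPath
  simp only [List.suffix_cons_iff]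
  constructor
  · intro h
    exact ⟨h _ (Or.inl rfl), fun r hr => h r (Or.inr hr)⟩
  · rintro ⟨h1, h2⟩ r (rfl | hr)
    · exact h1
    · exact h2 r hr

@[simp] lemma posX_nil : posX [] = 0 := by simp [posX]
@[simp] lemma posY_nil : posY [] = 0 := by simp [posY]
@[simp] lemma posX_E (l) : posX (Step.E :: l) = posX l + 1 := by simp [posX]; omega
@[simp] lemma posX_N (l) : posX (Step.N :: l) = posX l := by simp [posX]
@[simp] lemma posX_D (l) : posX (Step.D :: l) = posX l + 1 := by simp [posX]; omega
@[simp] lemma posY_E (l) : posY (Step.E :: l) = posY l := by simp [posY]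
@[simp] lemma posY_N (l) : posY (Step.N :: l) = posY l + 1 := by simp [posY]; omega
@[simp] lemma posY_D (l) : posY (Step.D :: l) = posY l + 1 := by simp [posY]; omega

def AF : ℕ → ℕ → Finset (List Step)
  | 0, 0 => {[]}
  | 0, _ + 1 => ∅
  | 1, 0 => ∅
  | 1, 1 => {[Step.N]}
  | 1, _ + 2 => ∅
  | N + 2, 0 => (AF (N + 1) 1).image (List.cons Step.E) ∪ (AF N 0).image (List.cons Step.D)
  | N + 2, h + 1 => (AF (N + 1) h).image (List.cons Step.N) ∪
      ((AF (N + 1) (h + 2)).image (List.cons Step.E) ∪ (AF N (h + 1)).image (List.cons Step.D))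

lemma mem_AF (N : ℕ) : ∀ (h : ℕ) (l : List Step),
    l ∈ AF N h ↔ RPath l ∧ posX l + posY l = N ∧ posY l = posX l + h := by
  induction N using Nat.twoStepInduction with
  | zero =>
    intro h l
    rcases h with _ | h <;> rcases l with _ | ⟨_ | _ | _, l⟩ <;>
      simp [AF, RPath_nil]
  | one =>
    intro h l
    rcases l with _ | ⟨s, l⟩
    · rcases h with _ | _ | h <;> simp [AF]
    · rcases l with _ | ⟨s', l⟩
      · rcases h with _ | _ | h <;> rcases s with _ | _ | _ <;> simp [AF, RPath_cons, RPath_nil]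
      · rcases h with _ | _ | h <;> rcases s with _ | _ | _ <;> rcases s' with _ | _ | _ <;>
          simp [AF] <;> intros <;> omega
  | more N ih1 ih2 =>
    intro h l
    have hr : ∀ l, RPath l → posX l ≤ posY l := fun l h => h l List.suffix_rfl
    rcases h with _ | h <;> rcases l with _ | ⟨_ | _ | _, l⟩ <;>
      simp [AF, RPath_cons, ih1, ih2] <;> grind

lemma AF_vanish (N : ℕ) : ∀ h, N < h → (AF N h).card = 0 := by
  intro h hh
  rw [Finset.card_eq_zero, Finset.eq_empty_iff_forall_notMem]
  intro l hl
  rw [mem_AF] at hl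
  omega

lemma cons_inj' (s : Step) : Function.Injective (List.cons s) := List.cons_injective

lemma AF_card0 (N : ℕ) : (AF (N + 2) 0).card = (AF (N + 1) 1).card + (AF N 0).card := by
  rw [AF, Finset.card_union_of_disjoint, Finset.card_image_of_injective _ (cons_inj' _),
    Finset.card_image_of_injective _ (cons_inj' _)]
  rw [Finset.disjoint_left]; grind

lemma AF_card1 (N h : ℕ) : (AF (N + 2) (h + 1)).card =
    (AF (N + 1) h).card + ((AF (N + 1) (h + 2)).card + (AF N (h + 1)).card) := by
  rw [AF, Finset.card_union_of_disjoint, Finset.card_union_of_disjoint,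
    Finset.card_image_of_injective _ (cons_inj' _),
    Finset.card_image_of_injective _ (cons_inj' _),
    Finset.card_image_of_injective _ (cons_inj' _)]
  all_goals rw [Finset.disjoint_left]; grind

def BN : ℕ → ℕ → ℕ → ℕ
  | 0, N, h => (AF N h).card
  | _ + 1, 0, _ => 0
  | k + 1, 1, h => BN k 0 (h + 1)
  | k + 1, N + 2, h => BN k N h + BN k (N + 1) (h + 1)

lemma BN_small (k h : ℕ) : BN (k + 1) 1 h = 0 := by
  rcases k with _ | k <;> simp [BN, AF]

lemma BN_vanish (k : ℕ) : ∀ N h, N < k + h → BN k N h = 0 := by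
  induction k with
  | zero => intro N h hh; rw [BN]; exact AF_vanish _ _ (by omega)
  | succ k ih =>
    intro N h hh
    rcases N with _ | _ | N
    · rw [BN]
    · exact BN_small _ _
    · rw [BN, ih _ _ (by omega), ih _ _ (by omega)]

lemma BN_key (k : ℕ) : ∀ N h,
    BN (k + 2) (N + 2) h + 2 * BN k N h = BN (k + 1) (N + 2) h + BN (k + 1) N h := by
  induction k with
  | zero =>
    intro N h
    rcases N with _ | _ | N
    · simp only [BN]
      rcases h with _ | h <;> simp [AF]
    · simp only [BN]
      have h1 := AF_card1 0 h
      have h2 := AF_vanish 1 (h + 2) (by omega)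
      simp only [zero_add] at h1
      have h3 := AF_vanish 0 (h + 1) (by omega)
      have h4 := AF_vanish 0 (h + 2) (by omega)
      simp only [zero_add, Nat.add_assoc, Nat.reduceAdd] at *
      omega
    · simp only [BN]
      have h1 := AF_card1 (N + 1) h
      have h2 : (AF (N + 2) h).card + 0 = (AF (N + 2) h).card := rfl
      simp only [Nat.add_assoc, Nat.reduceAdd] at *
      omega
  | succ k ih =>
    intro N h
    rcases N with _ | _ | N
    · have h1 := ih 0 h
      simp only [BN, zero_add] at *
      have h2 := BN_small k (h + 1)
      have h3 := BN_small (k + 1) (h + 1)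
      simp only [BN] at *
      omega
    · have h1 := ih 0 (h + 1)
      have h2 := BN_small (k + 1) h
      have h3 := BN_small (k) h
      have h4 := BN_small (k + 1) (h + 1)
      have e1 : BN (k + 1 + 2) (0 + 1 + 2) h = BN (k + 2) 1 h + BN (k + 2) 2 (h + 1) := by conv_lhs => rw [BN]
      have e2 : BN (k + 1 + 1) (0 + 1 + 2) h = BN (k + 1) 1 h + BN (k + 1) 2 (h + 1) := by conv_lhs => rw [BN]
      have e3 : BN (k + 1) (0 + 1) h = BN k 0 (h + 1) := by conv_lhs => rw [BN]
      have e4 : BN (k + 1 + 1) (0 + 1) h = BN (k + 1) 0 (h + 1) := by conv_lhs => rw [BN]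
      simp only [zero_add, Nat.add_assoc, Nat.reduceAdd] at *
      omega
    · have h1 := ih N h
      have h2 := ih (N + 1) (h + 1)
      have e1 : BN (k + 1 + 2) (N + 2 + 2) h =
        BN (k + 2) (N + 2) h + BN (k + 2) (N + 3) (h + 1) := by conv_lhs => rw [BN]
      have e2 : BN (k + 1 + 1) (N + 2 + 2) h =
        BN (k + 1) (N + 2) h + BN (k + 1) (N + 3) (h + 1) := by conv_lhs => rw [BN]
      have e3 : BN (k + 1) (N + 2) h = BN k N h + BN k (N + 1) (h + 1) := by conv_lhs => rw [BN]
      have e4 : BN (k + 1 + 1) (N + 2) h = BN (k + 1) N h + BN (k + 1) (N + 1) (h + 1) := by conv_lhs => rw [BN]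
      simp only [Nat.add_assoc, Nat.reduceAdd] at *
      omega

def UN (k N : ℕ) : ℕ := ∑ h ∈ Finset.range (N + 1), BN k N h

lemma UN_eq (k N M : ℕ) (hM : N < M) : UN k N = ∑ h ∈ Finset.range M, BN k N h := by
  unfold UN
  apply Finset.sum_subset
  · intro x hx; simp at *; omega
  · intro x _ hx; simp at hx; exact BN_vanish _ _ _ (by omega)

lemma UN_rec (k N : ℕ) :
    UN (k + 1) (N + 2) + UN (k + 1) N = UN (k + 2) (N + 2) + 2 * UN k N := by
  rw [UN_eq _ N (N + 3) (by omega), UN_eq _ N (N + 3) (by omega), UN, UN, Finset.mul_sum,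
    ← Finset.sum_add_distrib, ← Finset.sum_add_distrib]
  apply Finset.sum_congr rfl
  intro h _
  exact (BN_key k N h).symm

lemma UN_rec0 (N : ℕ) : UN 0 (N + 2) = UN 1 (N + 2) + UN 0 (N + 1) := by
  rw [UN_eq 0 (N + 2) (N + 4) (by omega), UN_eq 1 (N + 2) (N + 4) (by omega),
    UN_eq 0 (N + 1) (N + 3) (by omega), Finset.sum_range_succ' (fun h => BN 0 (N + 2) h),
    Finset.sum_range_succ' (fun h => BN 1 (N + 2) h)]
  simp only [BN, AF_card0, AF_card1, Finset.sum_add_distrib]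
  simp only [Nat.add_assoc, Nat.reduceAdd]
  ring

lemma UN_vanish (k N : ℕ) (h : N < k) : UN k N = 0 := by
  unfold UN
  exact Finset.sum_eq_zero (fun x _ => BN_vanish _ _ _ (by omega))

lemma UN_one (k : ℕ) : UN (k + 1) 1 = 0 := by
  unfold UN
  exact Finset.sum_eq_zero (fun x _ => BN_small _ _)

lemma UN_00 : UN 0 0 = 1 := by simp [UN, BN, AF]
lemma UN_01 : UN 0 1 = 1 := by simp [UN, BN, AF, Finset.sum_range_succ]

def XN : ℕ → ℕ → ℕ
  | 0, j => UN j 0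
  | n + 1, j => UN j (n + 1) + UN j n

lemma XN_rec (n j : ℕ) : XN (n + 2) (j + 1) + XN n (j + 1) = XN (n + 2) (j + 2) + 2 * XN n j := by
  rcases n with _ | n
  · have := UN_rec j 0
    have h1 := UN_one j
    have h2 := UN_one (j + 1)
    simp only [XN, zero_add, Nat.add_assoc, Nat.reduceAdd] at *
    omega
  · have h1 := UN_rec j (n + 1)
    have h2 := UN_rec j n
    simp only [XN] at *
    simp only [Nat.add_assoc, Nat.reduceAdd] at *
    omega

lemma XN_rec0 (n : ℕ) : XN (n + 2) 0 = XN (n + 2) 1 + XN (n + 1) 0 := by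
  rcases n with _ | n
  · have h1 := UN_rec0 0
    have h2 := UN_00
    have h3 := UN_01
    have h4 := UN_one 0
    simp only [XN, zero_add, Nat.reduceAdd] at *
    omega
  · have h1 := UN_rec0 (n + 1)
    have h2 := UN_rec0 n
    simp only [XN] at *
    simp only [Nat.add_assoc, Nat.reduceAdd] at *
    omega

lemma XN_vanish (n j : ℕ) (h : n < j) : XN n j = 0 := by
  rcases n with _ | n
  · exact UN_vanish _ _ h
  · rw [XN, UN_vanish _ _ h, UN_vanish _ _ (by omega)]

lemma VF_eq_XN (n : ℕ) : ∀ j, VF (n + 1) j = XN n j := by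
  induction n using Nat.twoStepInduction with
  | zero =>
    intro j
    rw [VF_one]
    rcases j with _ | j
    · simp [XN, UN_00]
    · rw [XN_vanish _ _ (by omega)]; simp
  | one =>
    intro j
    rw [VF_two]
    rcases j with _ | j
    · simp [XN, UN_00, UN_01]
    · simp [XN, UN_one, UN_vanish (j + 1) 0 (by omega)]
  | more n ih1 ih2 =>
    have key : ∀ m j, n + 3 < j + 1 + m → VF (n + 2 + 1) (j + 1) = XN (n + 2) (j + 1) := by
      intro m
      induction m with
      | zero => intro j hj; rw [VF_vanish _ _ (by omega), XN_vanish _ _ (by omega)]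
      | succ m ih =>
        intro j hj
        have h1 := VF_rec (n + 1) j (by omega)
        have h2 := XN_rec n j
        have h3 := ih (j + 1) (by omega)
        have h4 := ih1 j
        have h5 := ih1 (j + 1)
        simp only [Nat.add_assoc, Nat.reduceAdd] at *
        omega
    intro j
    rcases j with _ | j
    · have h1 := VF_rec0 (n + 1) (by omega)
      have h2 := XN_rec0 n
      have h3 := key (n + 3) 0 (by omega)
      have h4 := ih2 0
      simp only [Nat.add_assoc, Nat.reduceAdd, zero_add] at *
      omega
    · exact key (n + 3) j (by omega)

/-- all reversed prefixes of weight `N` -/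
def PF (N : ℕ) : Finset (List Step) := (Finset.range (N + 1)).biUnion (AF N)

lemma mem_PF (N : ℕ) (l : List Step) : l ∈ PF N ↔ RPath l ∧ posX l + posY l = N := by
  simp only [PF, Finset.mem_biUnion, Finset.mem_range, mem_AF]
  constructor
  · rintro ⟨h, _, h1, h2, _⟩; exact ⟨h1, h2⟩
  · rintro ⟨h1, h2⟩
    have := h1 l List.suffix_rfl
    exact ⟨posY l - posX l, by omega, h1, h2, by omega⟩

lemma card_PF (N : ℕ) : (PF N).card = UN 0 N := by
  rw [PF, Finset.card_biUnion]
  · simp [UN, BN]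
  · intro x _ y _ hxy
    change Disjoint (AF N x) (AF N y)
    rw [Finset.disjoint_left]
    intro l h1 h2
    rw [mem_AF] at h1 h2
    omega

lemma prefix_append_cases {q a b : List Step} (h : q <+: a ++ b) :
    q <+: a ∨ ∃ t, q = a ++ t ∧ t <+: b := by
  rcases List.prefix_or_prefix_of_prefix h (List.prefix_append a b) with h1 | ⟨t, rfl⟩
  · exact Or.inl h1
  · exact Or.inr ⟨t, rfl, (List.prefix_append_right_inj a).1 h⟩

lemma posX_append (p q) : posX (p ++ q) = posX p + posX q := by simp [posX]; omega
lemma posY_append (p q) : posY (p ++ q) = posY p + posY q := by simp [posY]; omega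
lemma posX_reverse (p) : posX p.reverse = posX p := by simp [posX]
lemma posY_reverse (p) : posY p.reverse = posY p := by simp [posY]
lemma posX_map (p : List Step) : posX (p.map revStep) = posY p := by
  induction p with
  | nil => simp
  | cons s p ih => rcases s with _ | _ | _ <;> simp [revStep, ih]
lemma posY_map (p : List Step) : posY (p.map revStep) = posX p := by
  induction p with
  | nil => simp
  | cons s p ih => rcases s with _ | _ | _ <;> simp [revStep, ih]

lemma revStep_invol (s : Step) : revStep (revStep s) = s := by cases s <;> rfl
lemma map_map_rev (p : List Step) : (p.map revStep).map revStep = p := by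
  rw [List.map_map]; convert List.map_id p; funext s; exact revStep_invol s

def dbl (m l : List Step) : List Step := l.reverse ++ (m ++ l.map revStep)

lemma dbl_rev (m l : List Step) (hm : m = [] ∨ m = [Step.D]) : revPath (dbl m l) = dbl m l := by
  rcases hm with rfl | rfl <;>
    simp [dbl, revPath, Function.comp_def, revStep_invol]
  rfl

lemma dbl_path (m l : List Step) (hm : m = [] ∨ m = [Step.D]) (hl : RPath l) :
    IsSchroderPath (posX l + posY l + m.length) (dbl m l) := by
  have hm' : posX m = m.length ∧ posY m = m.length := by rcases hm with rfl | rfl <;> simp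
  have hpre : ∀ q, q <+: l.reverse → posX q ≤ posY q := by
    intro q hq
    have := hl q.reverse (by rw [← List.reverse_prefix]; simpa using hq)
    rwa [posX_reverse, posY_reverse] at this
  have hfull := hpre _ List.prefix_rfl
  refine ⟨?_, ?_, ?_⟩
  · intro q hq
    rcases prefix_append_cases hq with hq | ⟨t, rfl, hq2⟩
    · exact hpre q hq
    · rw [posX_append, posY_append]
      rcases prefix_append_cases hq2 with hq | ⟨u, rfl, hq3⟩
      · have : posX t = posY t := by
          rcases hm with rfl | rfl
          · rw [List.prefix_nil] at hq; subst hq; simp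
          · rw [List.prefix_cons_iff] at hq
            rcases hq with rfl | ⟨t', rfl, ht'⟩
            · simp
            · rw [List.prefix_nil] at ht'; subst ht'; simp
        omega
      · rw [posX_append, posY_append]
        obtain ⟨v, hv⟩ := hq3
        have hl' : l = u.map revStep ++ v.map revStep := by
          rw [← List.map_append, hv, map_map_rev]
        have h1 := hl (v.map revStep) ⟨_, hl'.symm⟩
        have h2 := congrArg posX hl'
        have h3 := congrArg posY hl'
        rw [posX_append, posX_map, posX_map] at h2
        rw [posY_append, posY_map, posY_map] at h3
        rw [posX_map, posY_map] at h1
        rw [posX_reverse, posY_reverse]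
        omega
  · rw [dbl, posX_append, posX_append, posX_reverse, posX_map]; omega
  · rw [dbl, posY_append, posY_append, posY_reverse, posY_map]; omega

lemma dbl_inj (m : List Step) : Function.Injective (dbl m) := by
  intro l l' h
  have hlen : l.length = l'.length := by
    have := congrArg List.length h
    simp [dbl] at this; omega
  have := List.append_inj_left h (by simpa using hlen)
  simpa using this

lemma exists_dbl (p : List Step) (h : revPath p = p) :
    ∃ m l, (m = [] ∨ m = [Step.D]) ∧ p = dbl m l := by
  induction p using List.bidirectionalRec with
  | nil => exact ⟨[], [], Or.inl rfl, rfl⟩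
  | singleton s =>
    refine ⟨[Step.D], [], Or.inr rfl, ?_⟩
    rcases s with _ | _ | _ <;> simp [revPath, revStep, dbl] at *
  | cons_append a p b ih =>
    have h1 : revStep b = a ∧ revPath p = p := by
      simp only [revPath, List.reverse_cons, List.reverse_append, List.reverse_nil,
        List.nil_append, List.map_append, List.map_cons, List.map_nil, List.cons_append,
        List.cons.injEq] at h
      have h2 := List.append_inj h.2 (by simp)
      exact ⟨h.1, h2.1⟩
    obtain ⟨m, l, hm, hp⟩ := ih h1.2
    refine ⟨m, l ++ [a], hm, ?_⟩
    rw [hp, ← h1.1]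
    simp [dbl, revStep_invol]

lemma RPath_of_dbl (m l : List Step) (h : IsSchroderPrefix (dbl m l)) : RPath l := by
  intro r hr
  have := h r.reverse ((List.reverse_prefix.2 hr).trans (List.prefix_append _ _))
  rwa [posX_reverse, posY_reverse] at this

lemma dbl_size (n : ℕ) (m l : List Step) (hm : m = [] ∨ m = [Step.D])
    (h : IsSchroderPath n (dbl m l)) : RPath l ∧ posX l + posY l + m.length = n := by
  have h1 := RPath_of_dbl m l h.1
  exact ⟨h1, (dbl_path m l hm h1).2.1.symm.trans h.2.1⟩

lemma sym_zero : {p : List Step | IsSchroderPath 0 p ∧ revPath p = p} =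
    ((PF 0).image (dbl []) : Finset _) := by
  ext p
  simp only [Set.mem_ofPred_eq, Finset.coe_image, Set.mem_image, Finset.mem_coe, mem_PF]
  constructor
  · rintro ⟨h1, h2⟩
    obtain ⟨m, l, hm, rfl⟩ := exists_dbl p h2
    obtain ⟨h3, h4⟩ := dbl_size _ _ _ hm h1
    have : m = [] := List.length_eq_zero_iff.1 (by omega)
    subst this
    exact ⟨l, ⟨h3, by omega⟩, rfl⟩
  · rintro ⟨l, ⟨h1, h2⟩, rfl⟩
    have := dbl_path [] l (Or.inl rfl) h1
    rw [h2] at this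
    exact ⟨this, dbl_rev _ _ (Or.inl rfl)⟩

lemma sym_succ (n : ℕ) : {p : List Step | IsSchroderPath (n + 1) p ∧ revPath p = p} =
    ((PF (n + 1)).image (dbl []) ∪ (PF n).image (dbl [Step.D]) : Finset _) := by
  ext p
  simp only [Set.mem_ofPred_eq, Finset.coe_union, Finset.coe_image, Set.mem_union, Set.mem_image,
    Finset.mem_coe, mem_PF]
  constructor
  · rintro ⟨h1, h2⟩
    obtain ⟨m, l, hm, rfl⟩ := exists_dbl p h2
    obtain ⟨h3, h4⟩ := dbl_size _ _ _ hm h1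
    rcases hm with rfl | rfl
    · exact Or.inl ⟨l, ⟨h3, by simpa using h4⟩, rfl⟩
    · exact Or.inr ⟨l, ⟨h3, by simpa using h4⟩, rfl⟩
  · rintro (⟨l, ⟨h1, h2⟩, rfl⟩ | ⟨l, ⟨h1, h2⟩, rfl⟩)
    · have := dbl_path [] l (Or.inl rfl) h1
      rw [h2] at this
      exact ⟨this, dbl_rev _ _ (Or.inl rfl)⟩
    · have := dbl_path [Step.D] l (Or.inr rfl) h1
      rw [h2] at this
      exact ⟨this, dbl_rev _ _ (Or.inr rfl)⟩

lemma sym_card (n : ℕ) : Set.ncard {p : List Step | IsSchroderPath n p ∧ revPath p = p} =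
    XN n 0 := by
  rcases n with _ | n
  · rw [sym_zero, Set.ncard_coe_finset, Finset.card_image_of_injective _ (dbl_inj _), card_PF, XN]
  · rw [sym_succ, Set.ncard_coe_finset, Finset.card_union_of_disjoint,
      Finset.card_image_of_injective _ (dbl_inj _), Finset.card_image_of_injective _ (dbl_inj _),
      card_PF, card_PF, XN]
    rw [Finset.disjoint_left]
    intro p h1 h2
    rw [Finset.mem_image] at h1 h2
    obtain ⟨l, _, rfl⟩ := h1
    obtain ⟨l', _, h⟩ := h2
    have := congrArg List.length h
    simp [dbl] at this
    omega

theorem stmt_3 :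
    ∀ n : ℕ,
      Set.ncard {π : Equiv.Perm (Fin (n + 1)) |
          π⁻¹ = π ∧ Avoids π pat1243 ∧ Avoids π pat2143} =
        Set.ncard {p : List Step | IsSchroderPath n p ∧ revPath p = p} := by
  intro n
  rw [card_Ig, sym_card, ← VF_eq_XN, VF_zero]
end

section
/- For every n ≥ 0, the number of centrosymmetric permutations of {1,2,…,n+1} that avoid both of the patterns 1243 and 2143 equals the number of Schröder paths p ∈ D_n satisfying rev(ψ(p)) = p. -/
namespace PermSide

def eN (N p x : ℕ) : ℕ :=
  if x < min p (N + 1 - p) then x else if x + 1 < max p (N + 1 - p) then x + 1 else x + 2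

def em {N : ℕ} (p : Fin (N + 2)) (i : Fin N) : Fin (N + 2) :=
  ⟨eN N p i, by have := i.2; unfold eN; split_ifs <;> omega⟩

lemma em_val {N : ℕ} (p : Fin (N + 2)) (i : Fin N) : (em p i : ℕ) = eN N p i := rfl

lemma em_lt {N : ℕ} (p : Fin (N + 2)) (i j : Fin N) : em p i < em p j ↔ i < j := by
  rw [Fin.lt_def, Fin.lt_def, em_val, em_val]
  unfold eN
  split_ifs <;> omega

lemma em_inj {N : ℕ} (p : Fin (N + 2)) : Function.Injective (em p) := by
  intro i j h
  rcases lt_trichotomy i j with h1 | h1 | h1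
  · have := (em_lt p i j).2 h1; rw [h] at this; exact absurd this (lt_irrefl _)
  · exact h1
  · have := (em_lt p j i).2 h1; rw [h] at this; exact absurd this (lt_irrefl _)

lemma em_rev {N : ℕ} (p : Fin (N + 2)) (hp : 2 * (p : ℕ) ≠ N + 1) (i : Fin N) :
    em p i.rev = (em p i).rev := by
  have := i.2
  have := p.2
  ext
  rw [Fin.val_rev, em_val, em_val, Fin.val_rev]
  unfold eN
  split_ifs <;> omega

lemma em_ne {N : ℕ} (p : Fin (N + 2)) (i : Fin N) : em p i ≠ p := by
  have := i.2
  have := p.2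
  intro h
  have h := congrArg Fin.val h
  rw [em_val] at h
  unfold eN at h
  split_ifs at h <;> omega

lemma em_ne_rev {N : ℕ} (p : Fin (N + 2)) (i : Fin N) : em p i ≠ p.rev := by
  have := i.2
  have := p.2
  intro h
  have h := congrArg Fin.val h
  rw [em_val, Fin.val_rev] at h
  unfold eN at h
  split_ifs at h <;> omega

def EE {N : ℕ} (p : Fin (N + 2)) : Fin N ⊕ Bool → Fin (N + 2) :=
  Sum.elim (em p) (fun b => if b then p.rev else p)

lemma rev_ne {N : ℕ} (p : Fin (N + 2)) (hp : 2 * (p : ℕ) ≠ N + 1) : p.rev ≠ p := by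
  have := p.2
  intro h
  have h := congrArg Fin.val h
  rw [Fin.val_rev] at h
  omega

lemma EE_bij {N : ℕ} (p : Fin (N + 2)) (hp : 2 * (p : ℕ) ≠ N + 1) :
    Function.Bijective (EE p) := by
  rw [Fintype.bijective_iff_injective_and_card]
  constructor
  · rintro (i | b) (j | c) h
    · simp only [EE, Sum.elim_inl] at h
      rw [em_inj p h]
    · simp only [EE, Sum.elim_inl, Sum.elim_inr] at h
      cases c
      · exact absurd h (em_ne p i)
      · exact absurd h (em_ne_rev p i)
    · simp only [EE, Sum.elim_inl, Sum.elim_inr] at h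
      cases b
      · exact absurd h.symm (em_ne p j)
      · exact absurd h.symm (em_ne_rev p j)
    · simp only [EE, Sum.elim_inr] at h
      have := rev_ne p hp
      cases b <;> cases c
      · rfl
      · exact absurd h.symm this
      · exact absurd h this
      · rfl
  · simp

noncomputable def ins {N : ℕ} (p q : Fin (N + 2)) (hp : 2 * (p : ℕ) ≠ N + 1)
    (hq : 2 * (q : ℕ) ≠ N + 1) (σ : Equiv.Perm (Fin N)) : Equiv.Perm (Fin (N + 2)) :=
  (Equiv.ofBijective _ (EE_bij p hp)).symm.trans
    ((Equiv.sumCongr σ (Equiv.refl Bool)).trans (Equiv.ofBijective _ (EE_bij q hq)))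

section
variable {N : ℕ} (p q : Fin (N + 2)) (hp : 2 * (p : ℕ) ≠ N + 1) (hq : 2 * (q : ℕ) ≠ N + 1)
  (σ : Equiv.Perm (Fin N))

lemma ins_EE (x : Fin N ⊕ Bool) : ins p q hp hq σ (EE p x) = EE q (Sum.map σ id x) := by
  have h : (Equiv.ofBijective _ (EE_bij p hp)).symm (EE p x) = x := by
    rw [Equiv.symm_apply_eq]; rfl
  simp only [ins, Equiv.trans_apply, h]
  rfl

lemma ins_em (i : Fin N) : ins p q hp hq σ (em p i) = em q (σ i) :=
  ins_EE p q hp hq σ (Sum.inl i)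

lemma ins_p : ins p q hp hq σ p = q := ins_EE p q hp hq σ (Sum.inr false)

lemma ins_rev : ins p q hp hq σ p.rev = q.rev := ins_EE p q hp hq σ (Sum.inr true)

lemma cases_pos {N : ℕ} (p : Fin (N + 2)) (hp : 2 * (p : ℕ) ≠ N + 1) (x : Fin (N + 2)) : x = p ∨ x = p.rev ∨ ∃ i, x = em p i := by
  obtain ⟨y, rfl⟩ := (EE_bij p hp).2 x
  rcases y with i | b
  · exact Or.inr (Or.inr ⟨i, rfl⟩)
  · cases b
    · exact Or.inl rfl
    · exact Or.inr (Or.inl rfl)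

def Cs {N : ℕ} (π : Equiv.Perm (Fin N)) : Prop := ∀ i, π i.rev = (π i).rev

def Av {N : ℕ} (π : Equiv.Perm (Fin N)) : Prop :=
  ∀ a b c d : Fin N, a < b → b < c → c < d → π a < π d → π b < π d → π d < π c → False

instance {N : ℕ} (π : Equiv.Perm (Fin N)) : Decidable (Cs π) := by unfold Cs; infer_instance
instance {N : ℕ} (π : Equiv.Perm (Fin N)) : Decidable (Av π) := by unfold Av; infer_instance

lemma Av.dual {N : ℕ} {π : Equiv.Perm (Fin N)} (h : Av π) (hc : Cs π) :
    ∀ a b c d : Fin N, a < b → b < c → c < d → π b < π a → π a < π c → π a < π d → False := by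
  intro a b c d h1 h2 h3 h4 h5 h6
  apply h d.rev c.rev b.rev a.rev <;> (try rw [hc, hc]) <;> rw [Fin.rev_lt_rev] <;> assumption

lemma ins_Cs (h : Cs σ) : Cs (ins p q hp hq σ) := by
  intro x
  rcases cases_pos p hp x with rfl | rfl | ⟨i, rfl⟩
  · rw [ins_p, ins_rev]
  · rw [ins_rev, Fin.rev_rev, ins_p, Fin.rev_rev]
  · rw [← em_rev p hp, ins_em, ins_em, h, em_rev q hq]

lemma ins_inj {σ τ : Equiv.Perm (Fin N)} (h : ins p q hp hq σ = ins p q hp hq τ) : σ = τ := by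
  ext i
  have h1 := congrArg (fun f => f (em p i)) h
  simp only [ins_em] at h1
  rw [em_inj q h1]

lemma ins_surj (π : Equiv.Perm (Fin (N + 2))) (hc : Cs π) (h : π p = q) :
    ∃ σ, ins p q hp hq σ = π := by
  have hr : π p.rev = q.rev := by rw [hc, h]
  have key : ∀ i : Fin N, ∃ j : Fin N, π (em p i) = em q j := by
    intro i
    rcases cases_pos q hq (π (em p i)) with h1 | h1 | h1
    · rw [← h] at h1; exact absurd (π.injective h1) (em_ne p i)
    · rw [← hr] at h1; exact absurd (π.injective h1) (em_ne_rev p i)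
    · exact h1
  choose f hf using key
  have hinj : Function.Injective f := by
    intro i j hij
    have : π (em p i) = π (em p j) := by rw [hf, hf, hij]
    exact em_inj p (π.injective this)
  refine ⟨Equiv.ofBijective f (Finite.injective_iff_bijective.1 hinj), ?_⟩
  ext1 x
  rcases cases_pos p hp x with rfl | rfl | ⟨i, rfl⟩
  · rw [ins_p, h]
  · rw [ins_rev, hr]
  · rw [ins_em, hf]; rfl

lemma Cs_of_ins (h : Cs (ins p q hp hq σ)) : Cs σ := by
  intro i
  have := h (em p i)
  rw [← em_rev p hp, ins_em, ins_em, ← em_rev q hq] at this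
  exact em_inj q this

lemma Av_of_ins (h : Av (ins p q hp hq σ)) : Av σ := by
  intro a b c d h1 h2 h3 h4 h5 h6
  apply h (em p a) (em p b) (em p c) (em p d) <;> simp only [ins_em, em_lt] <;> assumption

/-- if every bad quadruple could be chosen off the inserted positions -/
lemma ins_Av (hσ : Av σ)
    (h : ∀ a b c d : Fin (N + 2), a < b → b < c → c < d →
      ins p q hp hq σ a < ins p q hp hq σ d → ins p q hp hq σ b < ins p q hp hq σ d →
      ins p q hp hq σ d < ins p q hp hq σ c →
      ∃ a b c d : Fin (N + 2), a < b ∧ b < c ∧ c < d ∧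
      ins p q hp hq σ a < ins p q hp hq σ d ∧ ins p q hp hq σ b < ins p q hp hq σ d ∧
      ins p q hp hq σ d < ins p q hp hq σ c ∧ (a ≠ p ∧ a ≠ p.rev) ∧ (b ≠ p ∧ b ≠ p.rev)
      ∧ (c ≠ p ∧ c ≠ p.rev) ∧ (d ≠ p ∧ d ≠ p.rev)) :
    Av (ins p q hp hq σ) := by
  intro a b c d h1 h2 h3 h4 h5 h6
  obtain ⟨a, b, c, d, h1, h2, h3, h4, h5, h6, ha, hb, hc, hd⟩ := h a b c d h1 h2 h3 h4 h5 h6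
  obtain ⟨a, rfl⟩ := ((cases_pos p hp a).resolve_left ha.1).resolve_left ha.2
  obtain ⟨b, rfl⟩ := ((cases_pos p hp b).resolve_left hb.1).resolve_left hb.2
  obtain ⟨c, rfl⟩ := ((cases_pos p hp c).resolve_left hc.1).resolve_left hc.2
  obtain ⟨d, rfl⟩ := ((cases_pos p hp d).resolve_left hd.1).resolve_left hd.2
  simp only [ins_em, em_lt] at *
  exact hσ a b c d h1 h2 h3 h4 h5 h6

end

def F (N : ℕ) : Finset (Equiv.Perm (Fin N)) := Finset.univ.filter (fun π => Cs π ∧ Av π)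

lemma mem_F {N : ℕ} {π : Equiv.Perm (Fin N)} : π ∈ F N ↔ Cs π ∧ Av π := by simp [F]

/-- the easy corner insertions -/
lemma ins_Av_easy {N : ℕ} (p q : Fin (N + 2)) (hp : 2 * (p : ℕ) ≠ N + 1)
    (hq : 2 * (q : ℕ) ≠ N + 1) (h1 : (p : ℕ) ≤ 1) (h2 : N ≤ (q : ℕ)) 
    (σ : Equiv.Perm (Fin N)) (hσ : Av σ) : Av (ins p q hp hq σ) := by
  apply ins_Av _ _ _ _ _ hσ
  intro a b c d hab hbc hcd h4 h5 h6
  refine ⟨a, b, c, d, hab, hbc, hcd, h4, h5, h6, ?_⟩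
  have e1 := ins_p p q hp hq σ
  have e2 := ins_rev p q hp hq σ
  have hq2 := q.2
  have hp2 := p.2
  set π := ins p q hp hq σ with hπ
  have nab : π a ≠ π b := fun h => hab.ne (π.injective h)
  have ca := (π c).2
  have v2 : (π p.rev : ℕ) = N + 1 - q := by rw [e2, Fin.val_rev]; omega
  have v1 : (π p : ℕ) = q := by rw [e1]
  have w2 : (p.rev : ℕ) = N + 1 - p := by rw [Fin.val_rev]; omega
  have hd := d.2
  rw [Fin.lt_def] at *
  have nab' : (π a : ℕ) ≠ π b := fun h => nab (Fin.ext h)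
  refine ⟨⟨?_, ?_⟩, ⟨?_, ?_⟩, ⟨?_, ?_⟩, ?_, ?_⟩ <;> rintro rfl <;> omega

lemma card_corner {N : ℕ} (p q : Fin (N + 2)) (hp : 2 * (p : ℕ) ≠ N + 1)
    (hq : 2 * (q : ℕ) ≠ N + 1) (h1 : (p : ℕ) ≤ 1) (h2 : N ≤ (q : ℕ))
    (P : Equiv.Perm (Fin N) → Prop) (P' : Equiv.Perm (Fin (N + 2)) → Prop) [DecidablePred P]
    [DecidablePred P'] (hP : ∀ σ, P σ ↔ P' (ins p q hp hq σ)) :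
    ((F (N + 2)).filter (fun π => π p = q ∧ P' π)).card = ((F N).filter P).card := by
  symm
  apply Finset.card_bij (fun σ _ => ins p q hp hq σ)
  · intro σ h
    simp only [Finset.mem_filter, mem_F] at h ⊢
    exact ⟨⟨ins_Cs _ _ _ _ _ h.1.1, ins_Av_easy _ _ _ _ h1 h2 _ h.1.2⟩, ins_p _ _ _ _ _,
      (hP σ).1 h.2⟩
  · intro σ _ τ _ h
    exact ins_inj _ _ _ _ h
  · intro π h
    simp only [Finset.mem_filter, mem_F] at h
    obtain ⟨σ, rfl⟩ := ins_surj p q hp hq π h.1.1 h.2.1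
    refine ⟨σ, ?_, rfl⟩
    simp only [Finset.mem_filter, mem_F]
    exact ⟨⟨Cs_of_ins _ _ _ _ _ h.1.1, Av_of_ins _ _ _ _ _ h.1.2⟩, (hP σ).2 h.2.2⟩

def R (N : ℕ) : Finset (Equiv.Perm (Fin (N + 3))) :=
  (F (N + 3)).filter (fun π => (π 0 : ℕ) ≠ N + 2 ∧ (π 0 : ℕ) ≠ N + 1 ∧ (π 1 : ℕ) ≠ N + 2)

lemma R_struct {N : ℕ} {π : Equiv.Perm (Fin (N + 3))} (h : π ∈ R N) :
    (π 0 : ℕ) < π 1 ∧ ((π 1 : ℕ) = N + 1 ∨ (π 2 : ℕ) = π 1 + 1) := by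
  simp only [R, Finset.mem_filter, mem_F] at h
  obtain ⟨⟨hc, ha⟩, h0, h0', h1⟩ := h
  have hd := ha.dual hc
  obtain ⟨m, hm⟩ := π.surjective ⟨N + 2, by omega⟩
  obtain ⟨t, ht⟩ := π.surjective ⟨N + 1, by omega⟩
  have hm' : (π m : ℕ) = N + 2 := by rw [hm]
  have ht' : (π t : ℕ) = N + 1 := by rw [ht]
  have z0 : ((0 : Fin (N + 3)) : ℕ) = 0 := rfl
  have z1 : ((1 : Fin (N + 3)) : ℕ) = 1 := by simp
  have z2 : ((2 : Fin (N + 3)) : ℕ) = 2 := by simp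
  have ne : ∀ x y : Fin (N + 3), (π x : ℕ) = π y → (x : ℕ) = y := by
    intro x y hxy; rw [π.injective (Fin.ext hxy)]
  have ne' : ∀ x y : Fin (N + 3), (x : ℕ) = y → (π x : ℕ) = π y := by
    intro x y hxy; rw [Fin.ext hxy]
  simp only [Fin.lt_def] at ha hd
  have b0 := (π 0).2
  have b1 := (π 1).2
  have b2 := (π 2).2
  have m0 := ne' m 0
  have m1 := ne' m 1
  have t0 := ne' t 0
  have t1 := ne' t 1
  have n01 := ne 0 1
  by_cases t1' : (t : ℕ) = 1
  · omega
  have htm : (t : ℕ) < m := by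
    by_contra hlt
    have := ne' m t
    have := ne 1 t
    exact ha 0 1 m t (by omega) (by omega) (by omega) (by omega) (by omega) (by omega)
  have n1t := ne 1 t
  have h01 : (π 0 : ℕ) < π 1 := by
    by_contra hlt
    exact hd 0 1 t m (by omega) (by omega) (by omega) (by omega) (by omega) (by omega)
  refine ⟨h01, Or.inr ?_⟩
  obtain ⟨y, hy⟩ := π.surjective ⟨π 1 + 1, by omega⟩
  have hy' : (π y : ℕ) = π 1 + 1 := by rw [hy]
  have y0 := ne' y 0
  have y1 := ne' y 1
  have y2 := ne' y 2
  by_cases hy2 : (y : ℕ) = 2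
  · omega
  exfalso
  have yt := ne' y t
  have yt' := ne y t
  have hyt : (y : ℕ) ≤ t := by
    by_contra hlt
    exact ha 0 1 t y (by omega) (by omega) (by omega) (by omega) (by omega) (by omega)
  have n21 := ne 2 1
  have n2y := ne 2 y
  have h12 : (π 1 : ℕ) < π 2 := by
    by_contra hlt
    exact hd 1 2 t m (by omega) (by omega) (by omega) (by omega) (by omega) (by omega)
  exact ha 0 1 2 y (by omega) (by omega) (by omega) (by omega) (by omega) (by omega)

lemma em_top' {N : ℕ} (q : Fin (N + 2)) (j : Fin N) (hN : 2 ≤ N) (h : (q : ℕ) = N) :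
    (em q j : ℕ) = N + 1 ↔ (j : ℕ) = N - 1 := by
  have := j.2
  rw [em_val]; unfold eN; split_ifs <;> omega

lemma c1 (N : ℕ) : ((F (N + 2)).filter (fun π => (π 0 : ℕ) = N + 1)).card = (F N).card := by
  have h := card_corner (N := N) 0 ⟨N + 1, by omega⟩ (by simp) (by simp only; omega) (by simp)
    (by simp) (fun _ => True) (fun _ => True) (fun _ => Iff.rfl)
  simp only [and_true, Finset.filter_true] at h
  rw [← h]
  congr 1
  apply Finset.filter_congr
  intro π _
  rw [Fin.ext_iff]

lemma c2 (N : ℕ) : ((F (N + 4)).filter (fun π => (π 0 : ℕ) = N + 2)).card = (F (N + 2)).card := by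
  have h := card_corner (N := N + 2) 0 ⟨N + 2, by omega⟩ (by simp) (by simp; omega) (by simp)
    (by simp) (fun _ => True) (fun _ => True) (fun _ => Iff.rfl)
  simp only [and_true, Finset.filter_true] at h
  rw [← h]
  congr 1
  apply Finset.filter_congr
  intro π _
  rw [Fin.ext_iff]

lemma c3 (N : ℕ) : ((F (N + 4)).filter (fun π => (π 1 : ℕ) = N + 3)).card = (F (N + 2)).card := by
  have h := card_corner (N := N + 2) 1 ⟨N + 3, by omega⟩ (by simp) (by simp only; omega) (by simp)
    (by simp) (fun _ => True) (fun _ => True) (fun _ => Iff.rfl)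
  simp only [and_true, Finset.filter_true] at h
  rw [← h]
  congr 1
  apply Finset.filter_congr
  intro π _
  rw [Fin.ext_iff]

lemma c4 (N : ℕ) : ((F (N + 4)).filter (fun π => (π 1 : ℕ) = N + 2)).card = (F (N + 2)).card := by
  have h := card_corner (N := N + 2) 1 ⟨N + 2, by omega⟩ (by simp) (by simp; omega) (by simp)
    (by simp) (fun _ => True) (fun _ => True) (fun _ => Iff.rfl)
  simp only [and_true, Finset.filter_true] at h
  rw [← h]
  congr 1
  apply Finset.filter_congr
  intro π _
  rw [Fin.ext_iff]

lemma c23 (N : ℕ) : ((F (N + 4)).filter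
    (fun π => (π 0 : ℕ) = N + 2 ∧ (π 1 : ℕ) = N + 3)).card = (F N).card := by
  rw [← c1 N, ← card_corner (N := N + 2) 0 ⟨N + 2, by omega⟩ (by simp) (by simp; omega) (by simp)
    (by simp) (fun σ => (σ 0 : ℕ) = N + 1) (fun π => (π 1 : ℕ) = N + 3)]
  · congr 1
    apply Finset.filter_congr
    intro π _
    rw [Fin.ext_iff]
  · intro σ
    have e : (1 : Fin (N + 2 + 2)) = em 0 0 := by
      ext; rw [em_val]; simp [eN]
    rw [e, ins_em, em_top']
    · simp
    · omega
    · simp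

lemma c14 (N : ℕ) : ((F (N + 4)).filter
    (fun π => (π 1 : ℕ) = N + 2 ∧ (π 0 : ℕ) = N + 3)).card = (F N).card := by
  rw [← c1 N, ← card_corner (N := N + 2) 1 ⟨N + 2, by omega⟩ (by simp) (by simp; omega) (by simp)
    (by simp) (fun σ => (σ 0 : ℕ) = N + 1) (fun π => (π 0 : ℕ) = N + 3)]
  · congr 1
    apply Finset.filter_congr
    intro π _
    rw [Fin.ext_iff]
  · intro σ
    have e : (0 : Fin (N + 2 + 2)) = em 1 0 := by
      ext; rw [em_val]; simp [eN]
    rw [e, ins_em, em_top']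
    · simp
    · omega
    · simp

lemma mem_R1 {N : ℕ} {π : Equiv.Perm (Fin (N + 4))} : π ∈ R (N + 1) ↔ π ∈ F (N + 4) ∧
    (π 0 : ℕ) ≠ N + 3 ∧ (π 0 : ℕ) ≠ N + 2 ∧ (π 1 : ℕ) ≠ N + 3 := by
  unfold R
  rw [Finset.mem_filter]

lemma mem_R2 {N : ℕ} {π : Equiv.Perm (Fin (N + 5))} : π ∈ R (N + 2) ↔ π ∈ F (N + 5) ∧
    (π 0 : ℕ) ≠ N + 4 ∧ (π 0 : ℕ) ≠ N + 3 ∧ (π 1 : ℕ) ≠ N + 4 := by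
  unfold R
  rw [Finset.mem_filter]

lemma card_F (N : ℕ) : (F (N + 4)).card + (F N).card = 3 * (F (N + 2)).card + (R (N + 1)).card := by
  have h1 : ((F (N + 4)).filter (fun π => (π 0 : ℕ) = N + 3)).card = (F (N + 2)).card := c1 (N + 2)
  have h2 := c2 N
  have h3 := c3 N
  have h23 := c23 N
  have e1 := Finset.card_filter_add_card_filter_not (s := F (N + 4))
    (fun π => (π 0 : ℕ) = N + 3)
  have e2 : (((F (N + 4)).filter (fun π => (π 0 : ℕ) = N + 2)) ∪
    ((F (N + 4)).filter (fun π => (π 1 : ℕ) = N + 3))) ∪ R (N + 1) =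
      (F (N + 4)).filter (fun π => ¬ (π 0 : ℕ) = N + 3) := by
    ext π
    have : (π 0 : ℕ) ≠ π 1 := by
      intro h
      have := π.injective (Fin.ext h)
      simp at this
    simp only [mem_R1, Finset.mem_union, Finset.mem_filter]
    by_cases hF : π ∈ F (N + 4)
    · simp only [hF, true_and]; omega
    · simp only [hF, false_and, or_self]
  have e3 := Finset.card_union_add_card_inter
    ((F (N + 4)).filter (fun π => (π 0 : ℕ) = N + 2))
    ((F (N + 4)).filter (fun π => (π 1 : ℕ) = N + 3))
  rw [← Finset.filter_and] at e3
  rw [← e2, Finset.card_union_of_disjoint] at e1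
  · omega
  · rw [Finset.disjoint_left]
    intro π h
    simp only [mem_R1, Finset.mem_union, Finset.mem_filter] at h ⊢
    rintro ⟨_, h⟩
    omega

/-- the value to be inserted -/
def qof {N : ℕ} (σ : Equiv.Perm (Fin (N + 3))) : Fin (N + 3 + 2) :=
  ⟨if 2 * (σ 1 : ℕ) < N + 3 then σ 1 else σ 1 + 1, by have := (σ 1).2; split_ifs <;> omega⟩

lemma qof_ne {N : ℕ} (σ : Equiv.Perm (Fin (N + 3))) : 2 * (qof σ : ℕ) ≠ N + 3 + 1 := by
  simp only [qof]; split_ifs <;> omega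

lemma one_ne (N : ℕ) : 2 * ((1 : Fin (N + 3 + 2)) : ℕ) ≠ N + 3 + 1 := by simp

lemma em1_0 (N : ℕ) : (0 : Fin (N + 3 + 2)) = em 1 0 := by
  ext; rw [em_val]; simp [eN]

lemma em1_1 (N : ℕ) : (2 : Fin (N + 3 + 2)) = em 1 1 := by
  ext; rw [em_val]; simp [eN]

lemma card_R'' (N : ℕ) : ((R (N + 2)).filter (fun π => (π 1 : ℕ) ≠ N + 3)).card = (R N).card := by
  symm
  apply Finset.card_bij (fun σ _ => ins 1 (qof σ) (one_ne N) (qof_ne σ) σ)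
  · intro σ h
    have hs := (R_struct h).1
    simp only [R, Finset.mem_filter, mem_F] at h ⊢
    obtain ⟨⟨hc, ha⟩, h0, h0', h1⟩ := h
    have cs := ins_Cs 1 (qof σ) (one_ne N) (qof_ne σ) σ hc
    have p0 : (ins 1 (qof σ) (one_ne N) (qof_ne σ) σ 0 : ℕ) = eN (N + 3) (qof σ) (σ 0) := by
      rw [em1_0, ins_em, em_val]
    have p2 : (ins 1 (qof σ) (one_ne N) (qof_ne σ) σ 2 : ℕ) = eN (N + 3) (qof σ) (σ 1) := by
      rw [em1_1, ins_em, em_val]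
    have p1 := congrArg Fin.val (ins_p 1 (qof σ) (one_ne N) (qof_ne σ) σ)
    have hq : (qof σ : ℕ) = if 2 * (σ 1 : ℕ) < N + 3 then (σ 1 : ℕ) else σ 1 + 1 := rfl
    have b0 := (σ 0).2
    have b1 := (σ 1).2
    have r2 : (ins 1 (qof σ) (one_ne N) (qof_ne σ) σ 2 : ℕ) =
        (ins 1 (qof σ) (one_ne N) (qof_ne σ) σ 1 : ℕ) + 1 := by
      rw [p2, p1, hq]; unfold eN; split_ifs <;> omega
    have r0 : (ins 1 (qof σ) (one_ne N) (qof_ne σ) σ 0 : ℕ) <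
        (ins 1 (qof σ) (one_ne N) (qof_ne σ) σ 1 : ℕ) := by
      rw [p0, p1, hq]; unfold eN; split_ifs <;> omega
    have r1 : (ins 1 (qof σ) (one_ne N) (qof_ne σ) σ 1 : ℕ) < N + 3 := by
      rw [p1, hq]; split_ifs <;> omega
    refine ⟨⟨⟨cs, ?_⟩, by omega, by omega, by omega⟩, by omega⟩
    apply ins_Av _ _ _ _ _ ha
    generalize ins 1 (qof σ) (one_ne N) (qof_ne σ) σ = π at *
    clear p0 p1 p2 hq
    intro a b c d hab hbc hcd had hbd hdc
    have z0 : ((0 : Fin (N + 3 + 2)) : ℕ) = 0 := rfl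
    have z1 : ((1 : Fin (N + 3 + 2)) : ℕ) = 1 := by simp
    have z2 : ((2 : Fin (N + 3 + 2)) : ℕ) = 2 := by simp
    have y0 : ((0 : Fin (N + 3 + 2)).rev : ℕ) = N + 4 := by simp
    have y1 : ((1 : Fin (N + 3 + 2)).rev : ℕ) = N + 3 := by simp
    have y2 : ((2 : Fin (N + 3 + 2)).rev : ℕ) = N + 2 := by rw [Fin.val_rev, z2]; omega
    have s0 : (π (Fin.rev 0) : ℕ) = N + 4 - π 0 := by rw [cs, Fin.val_rev]; omega
    have s1 : (π (Fin.rev 1) : ℕ) = N + 4 - π 1 := by rw [cs, Fin.val_rev]; omega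
    have s2 : (π (Fin.rev 2) : ℕ) = N + 4 - π 2 := by rw [cs, Fin.val_rev]; omega
    have ne : ∀ x y : Fin (N + 3 + 2), (π x : ℕ) = π y → (x : ℕ) = y := by
      intro x y hxy; rw [π.injective (Fin.ext hxy)]
    have ne' : ∀ x y : Fin (N + 3 + 2), (x : ℕ) = y → (π x : ℕ) = π y := by
      intro x y hxy; rw [Fin.ext hxy]
    have nee : ∀ x y : Fin (N + 3 + 2), x ≠ y ↔ (x : ℕ) ≠ y := by
      intro x y; rw [Ne, Fin.ext_iff]
    simp only [Fin.lt_def, nee] at *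
    have hd2 := d.2
    -- fix d
    have hd : ∃ d' : Fin (N + 3 + 2), (c : ℕ) < d' ∧ (π a : ℕ) < π d' ∧ (π b : ℕ) < π d' ∧
        (π d' : ℕ) < π c ∧ (d' : ℕ) ≠ N + 3 := by
      by_cases h : (d : ℕ) = N + 3
      · have e1 := ne' d (Fin.rev 1) (by omega)
        have e2 := ne' c (Fin.rev 2)
        have e3 := ne a (Fin.rev 2)
        have e4 := ne b (Fin.rev 2)
        exact ⟨Fin.rev 2, by omega, by omega, by omega, by omega, by omega⟩
      · exact ⟨d, by omega, by omega, by omega, by omega, h⟩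
    obtain ⟨d', k1, k2, k3, k4, k5⟩ := hd
    have hd2' := d'.2
    have hcN : (c : ℕ) ≠ N + 3 := by
      intro h
      have e1 := ne' c (Fin.rev 1) (by omega)
      have e2 := ne' d' (Fin.rev 0) (by omega)
      omega
    by_cases hb : (b : ℕ) = 1
    · have e1 := ne' b 1 (by omega)
      have e2 := ne' c 2
      have e3 := ne 2 d'
      exact ⟨a, 2, c, d', by omega, by omega, by omega, by omega, by omega, by omega, by omega,
        by omega, by omega, by omega⟩
    · by_cases ha1 : (a : ℕ) = 1
      · have e1 := ne' a 1 (by omega)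
        exact ⟨0, b, c, d', by omega, by omega, by omega, by omega, by omega, by omega, by omega,
          by omega, by omega, by omega⟩
      · exact ⟨a, b, c, d', by omega, by omega, by omega, by omega, by omega, by omega, by omega,
          by omega, by omega, by omega⟩
  · intro σ _ τ _ h
    have h1 := ins_p 1 (qof σ) (one_ne N) (qof_ne σ) σ
    have h2 := ins_p 1 (qof τ) (one_ne N) (qof_ne τ) τ
    have h3 : qof σ = qof τ := by rw [← h1, ← h2, h]
    have : ∀ (q q' : Fin (N + 3 + 2)) (hq : 2 * (q : ℕ) ≠ N + 3 + 1)
      (hq' : 2 * (q' : ℕ) ≠ N + 3 + 1), q = q' →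
      ins 1 q (one_ne N) hq σ = ins 1 q' (one_ne N) hq' τ → σ = τ := by
      rintro q q' hq hq' rfl h
      exact ins_inj _ _ _ _ h
    exact this _ _ _ _ h3 h
  · intro π h
    rw [Finset.mem_filter] at h
    obtain ⟨hR, hn⟩ := h
    obtain ⟨s0, s1⟩ := R_struct hR
    have s1 := s1.resolve_left hn
    simp only [R, Finset.mem_filter, mem_F] at hR
    obtain ⟨⟨hc, ha⟩, h0, h0', h1⟩ := hR
    have b1 := (π 1).2
    have hq : 2 * (π 1 : ℕ) ≠ N + 3 + 1 := by
      intro hq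
      have h2 := hc 1
      have h3 : (π 1).rev = π 1 := by
        ext; rw [Fin.val_rev]; omega
      rw [h3] at h2
      exact rev_ne _ (one_ne N) (π.injective h2)
    obtain ⟨σ, hσ⟩ := ins_surj 1 (π 1) (one_ne N) hq π hc rfl
    have p0 : (π 0 : ℕ) = eN (N + 3) (π 1) (σ 0) := by
      conv_lhs => rw [← hσ, em1_0, ins_em, em_val]
    have p2 : (π 2 : ℕ) = eN (N + 3) (π 1) (σ 1) := by
      conv_lhs => rw [← hσ, em1_1, ins_em, em_val]
    have bs0 := (σ 0).2
    have bs1 := (σ 1).2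
    have hqq : π 1 = qof σ := by
      ext
      rw [s1] at p2
      simp only [qof]
      unfold eN at p2
      split_ifs at p2 ⊢ <;> omega
    have hins : ins 1 (qof σ) (one_ne N) (qof_ne σ) σ = π := by
      have : ∀ (q : Fin (N + 3 + 2)) (hq' : 2 * (q : ℕ) ≠ N + 3 + 1), π 1 = q →
        ins 1 q (one_ne N) hq' σ = π := by
        rintro q hq' rfl; exact hσ
      exact this _ _ hqq
    refine ⟨σ, ?_, hins⟩
    rw [← hσ] at hc ha
    simp only [R, Finset.mem_filter, mem_F]
    refine ⟨⟨Cs_of_ins _ _ _ _ _ hc, Av_of_ins _ _ _ _ _ ha⟩, ?_, ?_, ?_⟩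
    · intro hs
      unfold eN at p0
      split_ifs at p0 <;> omega
    · intro hs
      unfold eN at p0
      split_ifs at p0 <;> omega
    · intro hs
      rw [s1] at p2
      unfold eN at p2
      split_ifs at p2 <;> omega

lemma card_R (N : ℕ) : (R (N + 2)).card + (F (N + 1)).card = (F (N + 3)).card + (R N).card := by
  have h4 : ((F (N + 5)).filter (fun π => (π 1 : ℕ) = N + 3)).card = (F (N + 3)).card := c4 (N + 1)
  have h14 : ((F (N + 5)).filter
    (fun π => (π 1 : ℕ) = N + 3 ∧ (π 0 : ℕ) = N + 4)).card = (F (N + 1)).card := c14 (N + 1)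
  have e := Finset.card_filter_add_card_filter_not (s := R (N + 2)) (fun π => (π 1 : ℕ) = N + 3)
  have e2 := card_R'' N
  have e3 := Finset.card_filter_add_card_filter_not
    (s := (F (N + 5)).filter (fun π => (π 1 : ℕ) = N + 3)) (fun π => (π 0 : ℕ) = N + 4)
  rw [Finset.filter_filter, Finset.filter_filter] at e3
  have e4 : (R (N + 2)).filter (fun π => (π 1 : ℕ) = N + 3) =
      (F (N + 5)).filter (fun π => (π 1 : ℕ) = N + 3 ∧ ¬ (π 0 : ℕ) = N + 4) := by
    ext π
    have : (π 0 : ℕ) ≠ π 1 := by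
      intro h
      have := π.injective (Fin.ext h)
      simp at this
    simp only [mem_R2, Finset.mem_filter]
    by_cases hF : π ∈ F (N + 5)
    · simp only [hF, true_and]; omega
    · simp only [hF, false_and]
  rw [e4] at e
  simp only [ne_eq] at e2
  omega

lemma F0 : (F 0).card = 1 := by decide +kernel
lemma F1 : (F 1).card = 1 := by decide +kernel
lemma F2 : (F 2).card = 2 := by decide +kernel
lemma F3 : (F 3).card = 2 := by decide +kernel
lemma R0 : (R 0).card = 1 := by decide +kernel
lemma R1 : (R 1).card = 2 := by decide +kernel

lemma R_eq : ∀ N, (R N).card = (F (N + 1)).card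
  | 0 => by rw [R0, F1]
  | 1 => by rw [R1, F2]
  | N + 2 => by
    have := card_R N
    have := R_eq N
    show _ = (F (N + 3)).card
    omega

lemma F_rec (N : ℕ) : (F (N + 4)).card + (F N).card = 4 * (F (N + 2)).card := by
  have := card_F N
  have := R_eq (N + 1)
  have e : N + 1 + 1 = N + 2 := rfl
  rw [e] at this
  omega

lemma avoids_iff {N : ℕ} (π : Equiv.Perm (Fin N)) :
    (Avoids π pat1243 ∧ Avoids π pat2143) ↔ Av π := by
  constructor
  · rintro ⟨h1, h2⟩ a b c d hab hbc hcd had hbd hdc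
    have hm : StrictMono ![a, b, c, d] := by
      rw [Fin.strictMono_iff_lt_succ]
      intro i
      fin_cases i <;> simpa
    have hac := had.trans hdc
    have hbc' := hbd.trans hdc
    rcases lt_trichotomy (π a) (π b) with h | h | h
    · apply h1
      refine ⟨![a, b, c, d], hm, ?_⟩
      intro i j
      fin_cases i <;> fin_cases j <;>
        simp [pat1243, Equiv.swap_apply_def, h, h.not_gt, hac, hac.not_gt, hbc', hbc'.not_gt, had, had.not_gt, hbd, hbd.not_gt,
          hdc, hdc.not_gt]
    · exact absurd (π.injective h) hab.ne
    · apply h2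
      refine ⟨![a, b, c, d], hm, ?_⟩
      intro i j
      fin_cases i <;> fin_cases j <;>
        simp [pat2143, Equiv.swap_apply_def, h, h.not_gt, hac, hac.not_gt, hbc', hbc'.not_gt, had, had.not_gt, hbd, hbd.not_gt,
          hdc, hdc.not_gt]
  · intro h
    constructor
    · rintro ⟨f, hf, hp⟩
      exact h (f 0) (f 1) (f 2) (f 3) (hf (by decide)) (hf (by decide)) (hf (by decide))
        ((hp 0 3).1 (by decide)) ((hp 1 3).1 (by decide)) ((hp 3 2).1 (by decide))
    · rintro ⟨f, hf, hp⟩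
      exact h (f 0) (f 1) (f 2) (f 3) (hf (by decide)) (hf (by decide)) (hf (by decide))
        ((hp 0 3).1 (by decide)) ((hp 1 3).1 (by decide)) ((hp 3 2).1 (by decide))

lemma rc_iff {N : ℕ} (π : Equiv.Perm (Fin N)) : rc π = π ↔ Cs π := by
  constructor
  · intro h i
    conv_lhs => rw [← h]
    simp [rc]
  · intro h
    ext1 i
    simp [rc, h i]

lemma ncard_F (N : ℕ) : Set.ncard {π : Equiv.Perm (Fin N) |
    rc π = π ∧ Avoids π pat1243 ∧ Avoids π pat2143} = (F N).card := by
  rw [← Set.ncard_coe_finset]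
  congr 1
  ext π
  simp only [Set.mem_ofPred_eq, avoids_iff, rc_iff, Finset.mem_coe, mem_F]

end PermSide

namespace PathSide

inductive Tok : Type
  | L : Tok
  | P : ℕ → Tok
  | S : ℕ → Tok
  deriving DecidableEq

inductive Cen : Type
  | nil : Cen
  | P : ℕ → Cen
  | S : ℕ → Cen
  deriving DecidableEq

def tw : Tok → List Step
  | Tok.L => [Step.D]
  | Tok.P k => List.replicate (k + 1) Step.N ++ List.replicate (k + 1) Step.E
  | Tok.S b => Step.E :: (List.replicate b Step.D ++ [Step.N])

def wt : Tok → ℕ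
  | Tok.L => 1
  | Tok.P k => k + 1
  | Tok.S b => b + 1

def sw : Tok → Tok
  | Tok.L => Tok.S 0
  | Tok.P k => Tok.P k
  | Tok.S 0 => Tok.L
  | Tok.S (b + 1) => Tok.S (b + 1)

def flat : List Tok → List Step
  | [] => []
  | t :: T => tw t ++ flat T

def wtl : List Tok → ℕ
  | [] => 0
  | t :: T => wt t + wtl T

lemma flat_append (T U : List Tok) : flat (T ++ U) = flat T ++ flat U := by
  induction T with
  | nil => rfl
  | cons t T ih => simp [flat, ih]

lemma wtl_append (T U : List Tok) : wtl (T ++ U) = wtl T + wtl U := by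
  induction T with
  | nil => simp [wtl]
  | cons t T ih => simp [wtl, ih]; omega

def W (a : ℕ) (T : List Tok) (b : ℕ) : List Step :=
  List.replicate a Step.D ++ Step.N :: (flat T ++ Step.E :: List.replicate b Step.D)

/-! shapes of D-words -/

lemma inner_flat {q : List Step} (h : IsInnerWord q) : ∃ T, q = flat T := by
  induction h with
  | nil => exact ⟨[], rfl⟩
  | dcons _ ih => obtain ⟨T, rfl⟩ := ih; exact ⟨Tok.L :: T, rfl⟩
  | @peak k p hk _ ih =>
    obtain ⟨T, rfl⟩ := ih
    obtain ⟨k, rfl⟩ : ∃ j, k = j + 1 := ⟨k - 1, by omega⟩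
    exact ⟨Tok.P k :: T, rfl⟩

lemma dword_shape {p : List Step} (h : IsDWord p) :
    (∃ n, p = List.replicate n Step.D) ∨ ∃ a T b, p = W a T b := by
  induction h with
  | nil => exact Or.inl ⟨0, rfl⟩
  | dcons _ ih =>
    rcases ih with ⟨n, rfl⟩ | ⟨a, T, b, rfl⟩
    · exact Or.inl ⟨n + 1, rfl⟩
    · exact Or.inr ⟨a + 1, T, b, rfl⟩
  | block hq _ ih =>
    obtain ⟨T, rfl⟩ := inner_flat hq
    rcases ih with ⟨n, rfl⟩ | ⟨a, U, b, rfl⟩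
    · exact Or.inr ⟨0, T, n, rfl⟩
    · refine Or.inr ⟨0, T ++ Tok.S a :: U, b, ?_⟩
      simp [W, flat_append, flat, tw]

lemma inner_append {p q : List Step} (hp : IsInnerWord p) (hq : IsInnerWord q) :
    IsInnerWord (p ++ q) := by
  induction hp with
  | nil => exact hq
  | dcons _ ih => exact IsInnerWord.dcons ih
  | peak hk _ ih =>
    rw [List.append_assoc]
    exact IsInnerWord.peak hk ih

lemma dword_rep (n : ℕ) {p : List Step} (h : IsDWord p) :
    IsDWord (List.replicate n Step.D ++ p) := by
  induction n with
  | zero => exact h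
  | succ n ih => exact IsDWord.dcons ih

lemma dword_flat (T : List Tok) (b : ℕ) : ∀ q, IsInnerWord q →
    IsDWord (Step.N :: (q ++ (flat T ++ Step.E :: List.replicate b Step.D))) := by
  induction T with
  | nil =>
    intro q hq
    have := dword_rep b IsDWord.nil
    rw [List.append_nil] at this
    exact IsDWord.block hq this
  | cons t T ih =>
    intro q hq
    cases t with
    | L =>
      have := ih (q ++ [Step.D]) (inner_append hq (IsInnerWord.dcons IsInnerWord.nil))
      simpa [flat, tw] using this
    | P k =>
      have := ih (q ++ (List.replicate (k + 1) Step.N ++ List.replicate (k + 1) Step.E ++ []))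
        (inner_append hq (IsInnerWord.peak (Nat.succ_pos k) IsInnerWord.nil))
      simpa [flat, tw] using this
    | S c =>
      have := IsDWord.block hq (dword_rep c (ih [] IsInnerWord.nil))
      simpa [flat, tw] using this

lemma dword_W (a : ℕ) (T : List Tok) (b : ℕ) : IsDWord (W a T b) :=
  dword_rep a (dword_flat T b [] IsInnerWord.nil)

/-! staying above the diagonal -/

def Safe (h : ℕ) (p : List Step) : Prop := ∀ q : List Step, q <+: p → posX q ≤ h + posY q

lemma safe_nil (h : ℕ) : Safe h [] := by
  intro q hq
  rw [List.prefix_nil] at hq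
  subst hq
  simp [posX]

lemma safe_D {h : ℕ} {p : List Step} (hp : Safe h p) : Safe h (Step.D :: p) := by
  intro q hq
  rw [List.prefix_cons_iff] at hq
  rcases hq with rfl | ⟨t, rfl, ht⟩
  · simp [posX]
  · have := hp t ht
    simp [posX, posY] at *
    omega

lemma safe_N {h : ℕ} {p : List Step} (hp : Safe (h + 1) p) : Safe h (Step.N :: p) := by
  intro q hq
  rw [List.prefix_cons_iff] at hq
  rcases hq with rfl | ⟨t, rfl, ht⟩
  · simp [posX]
  · have := hp t ht
    simp [posX, posY] at *
    omega

lemma safe_E {h : ℕ} {p : List Step} (hp : Safe h p) : Safe (h + 1) (Step.E :: p) := by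
  intro q hq
  rw [List.prefix_cons_iff] at hq
  rcases hq with rfl | ⟨t, rfl, ht⟩
  · simp [posX]
  · have := hp t ht
    simp [posX, posY] at *
    omega

lemma safe_repN (k : ℕ) : ∀ {h : ℕ} {p : List Step}, Safe (h + k) p →
    Safe h (List.replicate k Step.N ++ p) := by
  induction k with
  | zero => intro h p hp; exact hp
  | succ k ih =>
    intro h p hp
    exact safe_N (ih (by rwa [Nat.add_assoc, Nat.add_comm 1 k]))

lemma safe_repE (k : ℕ) : ∀ {h : ℕ} {p : List Step}, Safe h p →
    Safe (h + k) (List.replicate k Step.E ++ p) := by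
  induction k with
  | zero => intro h p hp; exact hp
  | succ k ih =>
    intro h p hp
    exact safe_E (ih hp)

lemma safe_inner {q r : List Step} (hq : IsInnerWord q) (hr : Safe 1 r) : Safe 1 (q ++ r) := by
  induction hq with
  | nil => exact hr
  | dcons _ ih => exact safe_D ih
  | peak _ _ ih =>
    rw [List.append_assoc, List.append_assoc]
    exact safe_repN _ (safe_repE _ ih)

lemma safe_dword {p : List Step} (hp : IsDWord p) : Safe 0 p := by
  induction hp with
  | nil => exact safe_nil 0
  | dcons _ ih => exact safe_D ih
  | block hq _ ih => exact safe_N (safe_inner hq (safe_E ih))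

lemma memD_iff (n : ℕ) (p : List Step) : MemD n p ↔ IsDWord p ∧ posX p = n ∧ posY p = n := by
  constructor
  · rintro ⟨h1, _, h2⟩; exact ⟨h1, h2⟩
  · rintro ⟨h1, h2⟩
    refine ⟨h1, ?_, h2⟩
    intro q hq
    have := safe_dword h1 q hq
    omega

lemma pos_flat (T : List Tok) : posX (flat T) = wtl T ∧ posY (flat T) = wtl T := by
  induction T with
  | nil => simp [flat, wtl, posX, posY]
  | cons t T ih =>
    cases t <;> simp [flat, wtl, posX, posY, tw, wt, List.count_append, List.count_cons,
      List.count_replicate] at * <;> omega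

lemma pos_W (a : ℕ) (T : List Tok) (b : ℕ) :
    posX (W a T b) = a + 1 + wtl T + b ∧ posY (W a T b) = a + 1 + wtl T + b := by
  have := pos_flat T
  simp [W, posX, posY, List.count_append, List.count_cons, List.count_replicate] at *
  omega

lemma pos_rep (n : ℕ) : posX (List.replicate n Step.D) = n ∧ posY (List.replicate n Step.D) = n := by
  simp [posX, posY, List.count_replicate]

/-! injectivity -/

lemma rep_inj {x y y' : Step} (hy : y ≠ x) (hy' : y' ≠ x) : ∀ (k k' : ℕ) (s s' : List Step),
    List.replicate k x ++ y :: s = List.replicate k' x ++ y' :: s' → k = k' ∧ y = y' ∧ s = s'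
  | 0, 0, s, s', h => by simpa using h
  | 0, k' + 1, s, s', h => by
    simp [List.replicate_succ] at h; exact absurd h.1 hy
  | k + 1, 0, s, s', h => by
    simp [List.replicate_succ] at h; exact absurd h.1.symm hy'
  | k + 1, k' + 1, s, s', h => by
    simp only [List.replicate_succ, List.cons_append, List.cons.injEq, true_and] at h
    obtain ⟨h1, h2, h3⟩ := rep_inj hy hy' k k' s s' h
    exact ⟨by omega, h2, h3⟩

lemma rep_ne {x y : Step} (hy : y ≠ x) (k k' : ℕ) (s : List Step)
    (h : List.replicate k x ++ y :: s = List.replicate k' x) : False := by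
  have : y ∈ List.replicate k' x := by rw [← h]; simp
  exact hy (List.eq_of_mem_replicate this)

lemma app_inj {s s' : List Step} (k : ℕ) (h : List.replicate k Step.E ++ s = List.replicate k Step.E ++ s') :
    s = s' := List.append_cancel_left h

lemma tail_inj : ∀ (T T' : List Tok) (b b' : ℕ),
    flat T ++ Step.E :: List.replicate b Step.D = flat T' ++ Step.E :: List.replicate b' Step.D →
    T = T' ∧ b = b' := by
  intro T
  induction T with
  | nil =>
    intro T' b b' h
    cases T' with
    | nil => simpa [flat] using h
    | cons t T' =>
      exfalso
      cases t with
      | L => simp [flat, tw] at h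
      | P k => simp [flat, tw, List.replicate_succ] at h
      | S c =>
        simp [flat, tw] at h
        exact rep_ne (by simp) _ _ _ h.symm
  | cons t T ih =>
    intro T' b b' h
    cases T' with
    | nil =>
      exfalso
      cases t with
      | L => simp [flat, tw] at h
      | P k => simp [flat, tw, List.replicate_succ] at h
      | S c =>
        simp [flat, tw] at h
        exact rep_ne (by simp) _ _ _ h
    | cons t' T' =>
      cases t with
      | L =>
        cases t' with
        | L =>
          simp [flat, tw] at h
          obtain ⟨rfl, rfl⟩ := ih T' b b' h
          exact ⟨rfl, rfl⟩
        | P k => simp [flat, tw, List.replicate_succ] at h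
        | S c => simp [flat, tw] at h
      | P k =>
        cases t' with
        | L => simp [flat, tw, List.replicate_succ] at h
        | P k' =>
          have h1 : List.replicate (k + 1) Step.N ++ Step.E :: (List.replicate k Step.E ++
              (flat T ++ Step.E :: List.replicate b Step.D)) =
            List.replicate (k' + 1) Step.N ++ Step.E :: (List.replicate k' Step.E ++
              (flat T' ++ Step.E :: List.replicate b' Step.D)) := by
            simpa [flat, tw, List.replicate_succ] using h
          obtain ⟨h2, _, h3⟩ := rep_inj (by simp) (by simp) _ _ _ _ h1
          obtain rfl : k = k' := by omega
          obtain ⟨rfl, rfl⟩ := ih T' b b' (List.append_cancel_left h3)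
          exact ⟨rfl, rfl⟩
        | S c => simp [flat, tw, List.replicate_succ] at h
      | S c =>
        cases t' with
        | L => simp [flat, tw] at h
        | P k' => simp [flat, tw, List.replicate_succ] at h
        | S c' =>
          have h1 : List.replicate c Step.D ++ Step.N ::
              (flat T ++ Step.E :: List.replicate b Step.D) =
            List.replicate c' Step.D ++ Step.N ::
              (flat T' ++ Step.E :: List.replicate b' Step.D) := by
            simpa [flat, tw] using h
          obtain ⟨rfl, _, h3⟩ := rep_inj (by simp) (by simp) _ _ _ _ h1
          obtain ⟨rfl, rfl⟩ := ih T' b b' h3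
          exact ⟨rfl, rfl⟩

lemma W_inj {a a' b b' : ℕ} {T T' : List Tok} (h : W a T b = W a' T' b') :
    a = a' ∧ T = T' ∧ b = b' := by
  obtain ⟨h1, _, h2⟩ := rep_inj (by simp) (by simp) _ _ _ _ h
  exact ⟨h1, tail_inj _ _ _ _ h2⟩

lemma W_ne {a b n : ℕ} {T : List Tok} : W a T b ≠ List.replicate n Step.D := by
  intro h
  exact rep_ne (by simp) _ _ _ h

/-! psi -/

lemma psi_repD (a : ℕ) (r : List Step) :
    psiAux 0 (List.replicate a Step.D ++ r) = List.replicate a Step.D ++ psiAux 0 r := by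
  induction a with
  | zero => rfl
  | succ a ih =>
    rw [List.replicate_succ, List.cons_append, psiAux, ih, List.cons_append]
    all_goals simp

lemma psi_repN (k : ℕ) : ∀ (h : ℕ) (r : List Step),
    psiAux h (List.replicate k Step.N ++ r) = List.replicate k Step.N ++ psiAux (h + k) r := by
  induction k with
  | zero => intro h r; rfl
  | succ k ih =>
    intro h r
    rw [List.replicate_succ, List.cons_append, psiAux, ih, List.cons_append, Nat.add_assoc,
      Nat.add_comm 1 k]

lemma psi_repE (k : ℕ) : ∀ (r : List Step),
    psiAux (1 + k) (List.replicate k Step.E ++ r) = List.replicate k Step.E ++ psiAux 1 r := by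
  induction k with
  | zero => intro r; rfl
  | succ k ih =>
    intro r
    rw [List.replicate_succ, List.cons_append, psiAux, List.cons_append]
    · rw [show 1 + (k + 1) - 1 = 1 + k by omega, ih]
    · intro _ h; omega

lemma psi_flat (T : List Tok) (b : ℕ) :
    psiAux 1 (flat T ++ Step.E :: List.replicate b Step.D) =
      flat (T.map sw) ++ Step.E :: List.replicate b Step.D := by
  induction T with
  | nil =>
    have h := psi_repD b []
    rw [List.append_nil, show psiAux 0 [] = [] by simp [psiAux], List.append_nil] at h
    show psiAux 1 (Step.E :: List.replicate b Step.D) = Step.E :: List.replicate b Step.D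
    rw [psiAux]
    · rw [show 1 - 1 = 0 from rfl, h]
    · intro r _ hr
      cases b <;> simp [List.replicate_succ] at hr
  | cons t T ih =>
    cases t with
    | L =>
      simp only [flat, tw, List.map_cons, sw, List.replicate_zero, List.nil_append,
        List.cons_append]
      rw [psiAux, ih]
    | P k =>
      simp only [flat, tw, List.map_cons, sw, List.append_assoc]
      rw [psi_repN, psi_repE, ih]
    | S c =>
      cases c with
      | zero =>
        simp only [flat, tw, List.map_cons, sw, List.replicate_zero, List.nil_append,
          List.cons_append]
        rw [psiAux, ih]
      | succ c =>
        simp only [flat, tw, List.map_cons, sw, List.append_assoc, List.cons_append,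
          List.nil_append]
        rw [psiAux]
        · rw [show 1 - 1 = 0 from rfl, psi_repD, psiAux, ih]
        · intro r _ hr
          simp [List.replicate_succ] at hr

lemma psi_W (a : ℕ) (T : List Tok) (b : ℕ) : psi (W a T b) = W a (T.map sw) b := by
  unfold psi W
  rw [psi_repD, psiAux, psi_flat]

lemma psi_rep (n : ℕ) : psi (List.replicate n Step.D) = List.replicate n Step.D := by
  have h := psi_repD n []
  rw [List.append_nil, show psiAux 0 [] = [] by simp [psiAux], List.append_nil] at h
  exact h

/-! reversal -/

lemma rev_append (p q : List Step) : revPath (p ++ q) = revPath q ++ revPath p := by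
  simp [revPath]

lemma rev_tw (t : Tok) : revPath (tw t) = tw t := by
  cases t <;> simp [revPath, tw, revStep]

lemma rev_flat (T : List Tok) : revPath (flat T) = flat T.reverse := by
  induction T with
  | nil => rfl
  | cons t T ih => simp [flat, rev_append, ih, flat_append, rev_tw]

lemma rev_rep (n : ℕ) : revPath (List.replicate n Step.D) = List.replicate n Step.D := by
  simp [revPath, revStep]

lemma rev_W (a : ℕ) (T : List Tok) (b : ℕ) : revPath (W a T b) = W b T.reverse a := by
  have : W a T b = List.replicate a Step.D ++ ([Step.N] ++ (flat T ++ ([Step.E] ++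
    List.replicate b Step.D))) := rfl
  rw [this, rev_append, rev_append, rev_append, rev_append, rev_flat, rev_rep, rev_rep]
  simp [W, revPath, revStep]

/-! swapped palindromes -/

lemma sw_sw (t : Tok) : sw (sw t) = t := by
  rcases t with _ | k | _ | b <;> rfl

def cl : Cen → List Tok
  | Cen.nil => []
  | Cen.P k => [Tok.P k]
  | Cen.S b => [Tok.S (b + 1)]

def cw : Cen → ℕ
  | Cen.nil => 0
  | Cen.P k => k + 1
  | Cen.S b => b + 2

def pal (x : List Tok × Cen) : List Tok := x.1 ++ cl x.2 ++ (x.1.map sw).reverse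

lemma wt_sw (t : Tok) : wt (sw t) = wt t := by
  rcases t with _ | k | _ | b <;> rfl

lemma wtl_sw (T : List Tok) : wtl (T.map sw).reverse = wtl T := by
  induction T with
  | nil => rfl
  | cons t T ih => simp [wtl, wtl_append, wt_sw] at *; omega

lemma wtl_pal (x : List Tok × Cen) : wtl (pal x) = 2 * wtl x.1 + cw x.2 := by
  obtain ⟨H, c⟩ := x
  have : wtl (cl c) = cw c := by cases c <;> simp [cl, cw, wtl, wt]
  simp only [pal, wtl_append, wtl_sw, this]; omega

lemma pal_fixed (x : List Tok × Cen) : ((pal x).map sw).reverse = pal x := by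
  obtain ⟨H, c⟩ := x
  have h2 : ((cl c).map sw).reverse = cl c := by cases c <;> simp [cl, sw]
  have h3 : sw ∘ sw = id := funext sw_sw
  simp only [pal, List.map_append, List.reverse_append, h2]
  simp [h3]

lemma pal_surj : ∀ (n : ℕ) (T : List Tok), T.length = n → (T.map sw).reverse = T →
    ∃ x, pal x = T := by
  intro n
  induction n using Nat.strong_induction_on with
  | _ n ih =>
    intro T hn hT
    rcases T with _ | ⟨t, T⟩
    · exact ⟨([], Cen.nil), rfl⟩
    · rcases List.eq_nil_or_concat T with rfl | ⟨U, u, rfl⟩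
      · rcases t with _ | k | _ | b
        · simp [sw] at hT
        · exact ⟨([], Cen.P k), rfl⟩
        · simp [sw] at hT
        · exact ⟨([], Cen.S b), rfl⟩
      · simp only [List.concat_eq_append, List.map_cons, List.map_append, List.reverse_cons, 
          List.reverse_append, List.map_nil, List.reverse_nil, List.nil_append, List.cons_append,
          List.cons.injEq] at hT
        obtain ⟨h1, h2⟩ := hT
        obtain ⟨h2, h3⟩ := List.append_inj' h2 rfl
        obtain ⟨x, hx⟩ := ih U.length (by simp at hn; omega) U rfl h2
        refine ⟨(t :: x.1, x.2), ?_⟩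
        simp only [List.cons.injEq, and_true] at h3
        rw [← hx, ← h3]
        simp [pal]

lemma pal_inj {x y : List Tok × Cen} (h : pal x = pal y) : x = y := by
  obtain ⟨H, c⟩ := x
  obtain ⟨H', c'⟩ := y
  have hl := congrArg List.length h
  have key : ∀ c, (cl c).length ≤ 1 := by intro c; cases c <;> simp [cl]
  have k1 := key c
  have k2 := key c'
  simp only [pal, List.length_append, List.length_reverse, List.length_map] at hl
  have hH : H.length = H'.length := by omega
  simp only [pal, List.append_assoc] at h
  obtain ⟨rfl, h2⟩ := List.append_inj h hH
  have h3 := List.append_cancel_right h2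
  have : c = c' := by
    cases c <;> cases c' <;> simp [cl] at h3 <;> simp [h3]
  rw [this]

/-! counting -/

def K (w : ℕ) : Set (List Tok × Cen) := {x | 2 * wtl x.1 + cw x.2 = w}

def M (n : ℕ) : Set (ℕ × (List Tok × Cen)) := {x | 2 * x.1 + 1 + (2 * wtl x.2.1 + cw x.2.2) = n}

def Phi (x : ℕ × (List Tok × Cen)) : List Step := W x.1 (pal x.2) x.1

lemma Phi_inj : Function.Injective Phi := by
  rintro ⟨a, x⟩ ⟨b, y⟩ h
  obtain ⟨rfl, h2, _⟩ := W_inj h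
  have h3 : x = y := pal_inj h2
  rw [h3]

lemma path_set (n : ℕ) : {p : List Step | MemD n p ∧ revPath (psi p) = p} =
    insert (List.replicate n Step.D) (Phi '' M n) := by
  ext p
  simp only [Set.mem_ofPred_eq, Set.mem_insert_iff, Set.mem_image, memD_iff]
  constructor
  · rintro ⟨⟨h1, h2, _⟩, h3⟩
    rcases dword_shape h1 with ⟨m, rfl⟩ | ⟨a, T, b, rfl⟩
    · left
      rw [(pos_rep m).1] at h2
      rw [h2]
    · right
      rw [psi_W, rev_W] at h3
      obtain ⟨rfl, h4, _⟩ := W_inj h3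
      obtain ⟨x, rfl⟩ := pal_surj _ T rfl h4
      refine ⟨(b, x), ?_, rfl⟩
      rw [(pos_W _ _ _).1, wtl_pal] at h2
      simp only [M, Set.mem_ofPred_eq]
      omega
  · rintro (rfl | ⟨⟨a, x⟩, h, rfl⟩)
    · refine ⟨⟨?_, pos_rep n⟩, ?_⟩
      · have := dword_rep n IsDWord.nil
        rwa [List.append_nil] at this
      · rw [psi_rep, rev_rep]
    · simp only [M, Set.mem_ofPred_eq] at h
      refine ⟨⟨dword_W _ _ _, ?_⟩, ?_⟩
      · have := pos_W a (pal x) a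
        rw [wtl_pal] at this
        simp only [Phi]
        omega
      · simp only [Phi]
        rw [psi_W, rev_W, pal_fixed]

def pre (t : Tok) (x : List Tok × Cen) : List Tok × Cen := (t :: x.1, x.2)

lemma pre_inj (t : Tok) : Function.Injective (pre t) := by
  rintro ⟨H, c⟩ ⟨H', c'⟩ h
  simp [pre] at h
  simp [h]

def grow : List Tok × Cen → List Tok × Cen
  | (Tok.P k :: H, c) => (Tok.P (k + 1) :: H, c)
  | (Tok.S k :: H, c) => (Tok.S (k + 1) :: H, c)
  | ([], Cen.P k) => ([], Cen.P (k + 2))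
  | ([], Cen.S k) => ([], Cen.S (k + 2))
  | x => x

lemma wt_pos (t : Tok) : 1 ≤ wt t := by cases t <;> simp [wt]

lemma K_rec (v : ℕ) : K (v + 4) = ((pre Tok.L '' K (v + 2) ∪ pre (Tok.S 0) '' K (v + 2)) ∪
    pre (Tok.P 0) '' K (v + 2)) ∪ grow '' (K (v + 2) \ pre Tok.L '' K v) := by
  ext ⟨H, c⟩
  simp only [Set.mem_union, Set.mem_image, Set.mem_diff, K, Set.mem_ofPred_eq]
  constructor
  · intro h
    rcases H with _ | ⟨t, H⟩
    · right
      rcases c with _ | k | k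
      · simp [wtl, cw] at h
      · simp [wtl, cw] at h
        refine ⟨([], Cen.P (k - 2)), ⟨?_, ?_⟩, ?_⟩
        · simp [wtl, cw]; omega
        · simp [pre]
        · simp [grow]; omega
      · simp [wtl, cw] at h
        refine ⟨([], Cen.S (k - 2)), ⟨?_, ?_⟩, ?_⟩
        · simp [wtl, cw]; omega
        · simp [pre]
        · simp [grow]; omega
    · simp only [wtl] at h
      rcases t with _ | (_ | k) | (_ | k)
      · left; left; left
        simp only [wt] at h
        exact ⟨(H, c), by simp only; omega, rfl⟩
      · left; right
        simp only [wt] at h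
        exact ⟨(H, c), by simp only; omega, rfl⟩
      · right
        simp only [wt] at h
        refine ⟨(Tok.P k :: H, c), ⟨?_, ?_⟩, rfl⟩
        · simp only [wtl, wt]; omega
        · simp [pre]
      · left; left; right
        simp only [wt] at h
        exact ⟨(H, c), by simp only; omega, rfl⟩
      · right
        simp only [wt] at h
        refine ⟨(Tok.S k :: H, c), ⟨?_, ?_⟩, rfl⟩
        · simp only [wtl, wt]; omega
        · simp [pre]
  · rintro (((⟨⟨H', c'⟩, h, he⟩ | ⟨⟨H', c'⟩, h, he⟩) | ⟨⟨H', c'⟩, h, he⟩) |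
      ⟨⟨H', c'⟩, ⟨h, hn⟩, he⟩)
    · simp [pre] at he; obtain ⟨rfl, rfl⟩ := he; simp [wtl, wt] at *; omega
    · simp [pre] at he; obtain ⟨rfl, rfl⟩ := he; simp [wtl, wt] at *; omega
    · simp [pre] at he; obtain ⟨rfl, rfl⟩ := he; simp [wtl, wt] at *; omega
    · rcases H' with _ | ⟨_ | k | k, H'⟩
      · rcases c' with _ | k | k
        · simp [wtl, cw] at h
        · simp [grow] at he; obtain ⟨rfl, rfl⟩ := he; simp [wtl, cw] at *; omega
        · simp [grow] at he; obtain ⟨rfl, rfl⟩ := he; simp [wtl, cw] at *; omega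
      · exfalso
        apply hn
        refine ⟨(H', c'), ?_, rfl⟩
        simp [wtl, wt] at *; omega
      · simp [grow] at he; obtain ⟨rfl, rfl⟩ := he; simp [wtl, wt] at *; omega
      · simp [grow] at he; obtain ⟨rfl, rfl⟩ := he; simp [wtl, wt] at *; omega

lemma K_cons (w : ℕ) (t : Tok) (H : List Tok) (c : Cen) (h : (t :: H, c) ∈ K w) :
    w ≥ 2 * wt t ∧ (H, c) ∈ K (w - 2 * wt t) := by
  simp only [K, Set.mem_ofPred_eq, wtl] at *
  omega

lemma K0 : K 0 = (({([], Cen.nil)} : Finset (List Tok × Cen)) : Set (List Tok × Cen)) := by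
  ext ⟨H, c⟩
  simp only [K, Set.mem_ofPred_eq, Finset.coe_singleton, Set.mem_singleton_iff, Prod.mk.injEq]
  rcases H with _ | ⟨t, H⟩
  · cases c <;> simp [wtl, cw]
  · have := wt_pos t
    simp [wtl]; omega

lemma K1 : K 1 = (({([], Cen.P 0)} : Finset (List Tok × Cen)) : Set (List Tok × Cen)) := by
  ext ⟨H, c⟩
  simp only [K, Set.mem_ofPred_eq, Finset.coe_singleton, Set.mem_singleton_iff, Prod.mk.injEq]
  rcases H with _ | ⟨t, H⟩
  · cases c <;> simp [wtl, cw]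
  · have := wt_pos t
    simp [wtl]; omega

lemma K2 : K 2 = (({([], Cen.P 1), ([], Cen.S 0), ([Tok.L], Cen.nil), ([Tok.P 0], Cen.nil),
    ([Tok.S 0], Cen.nil)} : Finset (List Tok × Cen)) : Set (List Tok × Cen)) := by
  ext ⟨H, c⟩
  simp only [K, Set.mem_ofPred_eq, Finset.coe_insert, Finset.coe_singleton, Set.mem_insert_iff,
    Set.mem_singleton_iff, Prod.mk.injEq]
  rcases H with _ | ⟨t, _ | ⟨t', H⟩⟩
  · cases c <;> simp [wtl, cw]
  · cases t <;> cases c <;> simp [wtl, wt, cw] <;> omega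
  · have := wt_pos t
    have := wt_pos t'
    simp [wtl]; omega

lemma K3 : K 3 = (({([], Cen.P 2), ([], Cen.S 1), ([Tok.L], Cen.P 0), ([Tok.P 0], Cen.P 0),
    ([Tok.S 0], Cen.P 0)} : Finset (List Tok × Cen)) : Set (List Tok × Cen)) := by
  ext ⟨H, c⟩
  simp only [K, Set.mem_ofPred_eq, Finset.coe_insert, Finset.coe_singleton, Set.mem_insert_iff,
    Set.mem_singleton_iff, Prod.mk.injEq]
  rcases H with _ | ⟨t, _ | ⟨t', H⟩⟩
  · cases c <;> simp [wtl, cw]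
  · cases t <;> cases c <;> simp [wtl, wt, cw] <;> omega
  · have := wt_pos t
    have := wt_pos t'
    simp [wtl]; omega

lemma K_fin : ∀ w, (K w).Finite
  | 0 => by rw [K0]; exact Finset.finite_toSet _
  | 1 => by rw [K1]; exact Finset.finite_toSet _
  | 2 => by rw [K2]; exact Finset.finite_toSet _
  | 3 => by rw [K3]; exact Finset.finite_toSet _
  | v + 4 => by
    rw [K_rec]
    have h := K_fin (v + 2)
    exact (((h.image _).union (h.image _)).union (h.image _)).union ((h.diff).image _)

lemma k0 : (K 0).ncard = 1 := by rw [K0, Set.ncard_coe_finset]; rfl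
lemma k1 : (K 1).ncard = 1 := by rw [K1, Set.ncard_coe_finset]; rfl
lemma k2 : (K 2).ncard = 5 := by rw [K2, Set.ncard_coe_finset]; rfl
lemma k3 : (K 3).ncard = 5 := by rw [K3, Set.ncard_coe_finset]; rfl

lemma preL_sub (v : ℕ) : pre Tok.L '' K v ⊆ K (v + 2) := by
  rintro _ ⟨⟨H, c⟩, h, rfl⟩
  simp [K, pre, wtl, wt] at *
  omega

lemma not_L {v : ℕ} {H : List Tok} {c : Cen} (h : (Tok.L :: H, c) ∈ K (v + 2)) :
    (Tok.L :: H, c) ∈ pre Tok.L '' K v := by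
  refine ⟨(H, c), ?_, rfl⟩
  simp [K, wtl, wt] at *
  omega

lemma not_nil {v : ℕ} (h : ([], Cen.nil) ∈ K (v + 2)) : False := by
  simp [K, wtl, cw] at h

lemma grow_inj (v : ℕ) : Set.InjOn grow (K (v + 2) \ pre Tok.L '' K v) := by
  rintro ⟨H, c⟩ ⟨h, hn⟩ ⟨H', c'⟩ ⟨h', hn'⟩ he
  rcases H with _ | ⟨_ | k | k, H⟩
  · rcases c with _ | k | k
    · exact (not_nil h).elim
    all_goals
      rcases H' with _ | ⟨_ | k' | k', H'⟩
      · rcases c' with _ | k' | k'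
        · exact (not_nil h').elim
        all_goals simp [grow] at he
        all_goals simp [he]
      all_goals simp [grow] at he
  · exact (hn (not_L h)).elim
  all_goals
    rcases H' with _ | ⟨_ | k' | k', H'⟩
    · rcases c' with _ | k' | k'
      · exact (not_nil h').elim
      all_goals simp [grow] at he
    · exact (hn' (not_L h')).elim
    all_goals simp [grow] at he
    all_goals simp [he]

lemma K_card (v : ℕ) : (K (v + 4)).ncard + (K v).ncard = 4 * (K (v + 2)).ncard := by
  have hf := K_fin (v + 2)
  haveI : Finite (K (v + 2)) := hf.to_subtype
  have hg : ∀ x ∈ K (v + 2) \ pre Tok.L '' K v, ∀ t ∈ [Tok.L, Tok.S 0, Tok.P 0],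
      ∀ y, pre t y ≠ grow x := by
    rintro ⟨H, c⟩ ⟨h, hn⟩ t ht y hy
    rcases H with _ | ⟨_ | k | k, H⟩
    · rcases c with _ | k | k <;> simp [grow, pre] at hy
    · exact hn (not_L h)
    · simp [grow, pre] at hy
      simp [hy.1.1] at ht
    · simp [grow, pre] at hy
      simp [hy.1.1] at ht
  rw [K_rec, Set.ncard_union_eq, Set.ncard_union_eq, Set.ncard_union_eq,
    Set.ncard_image_of_injective _ (pre_inj _), Set.ncard_image_of_injective _ (pre_inj _),
    Set.ncard_image_of_injective _ (pre_inj _), Set.ncard_image_of_injOn (grow_inj v)]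
  · have h1 := Set.ncard_sdiff_add_ncard_of_subset (preL_sub v) hf
    rw [Set.ncard_image_of_injective _ (pre_inj _)] at h1
    omega
  · rw [Set.disjoint_left]
    rintro _ ⟨x, _, rfl⟩ ⟨y, _, h⟩
    simp [pre] at h
  · rw [Set.disjoint_left]
    rintro _ (⟨x, _, rfl⟩ | ⟨x, _, rfl⟩) ⟨y, _, h⟩ <;> simp [pre] at h
  · rw [Set.disjoint_left]
    rintro _ ((⟨x, _, rfl⟩ | ⟨x, _, rfl⟩) | ⟨x, _, rfl⟩) ⟨y, hy, h⟩ <;>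
      exact hg y hy _ (by simp) _ h.symm

lemma M_rec (n : ℕ) : M (n + 2) = (fun x => (x.1 + 1, x.2)) '' M n ∪
    (fun x => (0, x)) '' K (n + 1) := by
  ext ⟨a, H, c⟩
  simp only [M, K, Set.mem_union, Set.mem_image, Set.mem_ofPred_eq]
  constructor
  · intro h
    rcases a with _ | a
    · right; exact ⟨(H, c), by simp only; omega, rfl⟩
    · left; exact ⟨(a, H, c), by simp only; omega, rfl⟩
  · rintro (⟨⟨a', H', c'⟩, h, he⟩ | ⟨⟨H', c'⟩, h, he⟩) <;> simp at he <;>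
      obtain ⟨rfl, rfl, rfl⟩ := he <;> simp only at h <;> omega

lemma M0 : M 0 = ∅ := by
  ext ⟨a, H, c⟩
  simp [M]

lemma M1 : M 1 = (fun x => (0, x)) '' K 0 := by
  ext ⟨a, H, c⟩
  simp only [M, K, Set.mem_image, Set.mem_ofPred_eq]
  constructor
  · intro h
    obtain rfl : a = 0 := by omega
    exact ⟨(H, c), by simp only; omega, rfl⟩
  · rintro ⟨⟨H', c'⟩, h, he⟩
    simp at he
    obtain ⟨rfl, rfl, rfl⟩ := he; simp only at h; omega

lemma M_fin : ∀ n, (M n).Finite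
  | 0 => by rw [M0]; exact Set.finite_empty
  | 1 => by rw [M1]; exact (K_fin 0).image _
  | n + 2 => by rw [M_rec]; exact ((M_fin n).image _).union ((K_fin _).image _)

lemma zero_inj : Function.Injective (fun x : List Tok × Cen => ((0 : ℕ), x)) := by
  intro x y h; simpa using h

lemma M_card (n : ℕ) : (M (n + 2)).ncard = (M n).ncard + (K (n + 1)).ncard := by
  haveI := (M_fin n).to_subtype
  haveI := (K_fin (n + 1)).to_subtype
  rw [M_rec, Set.ncard_union_eq, Set.ncard_image_of_injective, Set.ncard_image_of_injective]
  · exact zero_inj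
  · rintro ⟨a, x⟩ ⟨b, y⟩ h
    simpa using h
  · rw [Set.disjoint_left]
    rintro _ ⟨x, _, rfl⟩ ⟨y, _, h⟩
    simp at h

lemma m0 : (M 0).ncard = 0 := by rw [M0, Set.ncard_empty]
lemma m1 : (M 1).ncard = 1 := by rw [M1, Set.ncard_image_of_injective _ zero_inj, k0]

lemma M_rec4 : ∀ n, (M (n + 4)).ncard + 1 + ((M n).ncard + 1) = 4 * ((M (n + 2)).ncard + 1)
  | 0 => by
    have h1 := M_card 0
    have h2 := M_card 2
    have := k1
    have := k3
    have := m0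
    simp only [Nat.zero_add, Nat.reduceAdd] at *
    omega
  | 1 => by
    have h1 := M_card 1
    have h2 := M_card 3
    have := K_card 0
    have := k0
    have := k2
    have := m1
    simp only [Nat.zero_add, Nat.reduceAdd] at *
    omega
  | n + 2 => by
    have ih := M_rec4 n
    have h1 := M_card n
    have h2 := M_card (n + 2)
    have h3 := M_card (n + 4)
    have h4 := K_card (n + 1)
    simp only [Nat.add_assoc, Nat.reduceAdd] at *
    omega

lemma ncard_path (n : ℕ) : Set.ncard {p : List Step | MemD n p ∧ revPath (psi p) = p} =
    (M n).ncard + 1 := by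
  haveI := (M_fin n).to_subtype
  rw [path_set, Set.ncard_insert_of_notMem, Set.ncard_image_of_injective _ Phi_inj]
  · rintro ⟨x, _, h⟩
    exact W_ne h

end PathSide

lemma main_count : ∀ n : ℕ, (PermSide.F (n + 1)).card = (PathSide.M n).ncard + 1
  | 0 => by rw [PermSide.F1, PathSide.m0]
  | 1 => by rw [PermSide.F2, PathSide.m1]
  | 2 => by rw [PermSide.F3, PathSide.M_card 0, PathSide.m0, PathSide.k1]
  | 3 => by
    have h := PermSide.F_rec 0
    have h1 := PathSide.M_card 1
    have := PermSide.F0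
    have := PermSide.F2
    have := PathSide.m1
    have := PathSide.k2
    simp only [Nat.zero_add, Nat.reduceAdd] at *
    omega
  | n + 4 => by
    have h : (PermSide.F (n + 5)).card + (PermSide.F (n + 1)).card =
        4 * (PermSide.F (n + 3)).card := PermSide.F_rec (n + 1)
    have h1 := PathSide.M_rec4 n
    have i1 := main_count n
    have i2 : (PermSide.F (n + 3)).card = (PathSide.M (n + 2)).ncard + 1 := main_count (n + 2)
    show (PermSide.F (n + 5)).card = (PathSide.M (n + 4)).ncard + 1
    omega

theorem stmt_5 :
    ∀ n : ℕ,
      Set.ncard {π : Equiv.Perm (Fin (n + 1)) |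
          rc π = π ∧ Avoids π pat1243 ∧ Avoids π pat2143} =
        Set.ncard {p : List Step | MemD n p ∧ revPath (psi p) = p} := by
  intro n
  rw [PermSide.ncard_F, PathSide.ncard_path, main_count]
end
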